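/- arXiv:1809.07918 — 3 statements merged into one kernel-verified Lean document; each statement's English description precedes it below -/
import Mathlib

section
/- Let Ω be a properly convex quasi-homogeneous affine domain in ℝⁿ. Then the set of extreme points of the closure of Ω is a closed subset of ℝⁿ: any point of ℝⁿ that is the limit of a sequence of extreme points of the closure of Ω is itself an extreme point of the closure of Ω. -/
open Matrix Set Filter Topology Pointwise

noncomputable section

/-- The affine action on ℝⁿ of an (n+1)×(n+1) invertible matrix in affine form
(ℝⁿ is identified with the hyperplane x_{n+1} = 1). -/
def affAct (n : ℕ) (g : GL (Fin (n + 1)) ℝ) (x : Fin n → ℝ) : Fin n → ℝ :=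
  fun i => (∑ j : Fin n, g.val i.castSucc j.castSucc * x j) + g.val i.castSucc (Fin.last n)

/-- A matrix in GL(n+1,ℝ) has affine form if its last row is (0, …, 0, 1). -/
def IsAffineForm (n : ℕ) (g : GL (Fin (n + 1)) ℝ) : Prop :=
  (∀ j : Fin n, g.val (Fin.last n) j.castSucc = 0) ∧ g.val (Fin.last n) (Fin.last n) = 1

/-- Aut(Ω): the group (here: set) of affine transformations of ℝⁿ preserving Ω,
realized as affine-form matrices in GL(n+1,ℝ). -/
def AutSet (n : ℕ) (Ω : Set (Fin n → ℝ)) : Set (GL (Fin (n + 1)) ℝ) :=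
  {g | IsAffineForm n g ∧ affAct n g '' Ω = Ω}

/-- Aut⁰(Ω): the identity component of Aut(Ω). -/
def AutIdComp (n : ℕ) (Ω : Set (Fin n → ℝ)) : Set (GL (Fin (n + 1)) ℝ) :=
  connectedComponentIn (AutSet n Ω) 1

/-- The limit set Λ_G of a subset G of Aut(Ω). -/
def limitSet (n : ℕ) (Ω : Set (Fin n → ℝ)) (G : Set (GL (Fin (n + 1)) ℝ)) :
    Set (Fin n → ℝ) :=
  {ξ | ξ ∈ frontier Ω ∧ ∃ x ∈ Ω, ∃ u : ℕ → GL (Fin (n + 1)) ℝ,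
    (∀ k, u k ∈ G) ∧ Filter.Tendsto (fun k => affAct n (u k) x) Filter.atTop (nhds ξ)}

/-- Ω is a convex affine domain: a nonempty open convex subset of ℝⁿ. -/
def IsConvexDomain (n : ℕ) (Ω : Set (Fin n → ℝ)) : Prop :=
  Ω.Nonempty ∧ IsOpen Ω ∧ Convex ℝ Ω

/-- Ω contains no complete affine line. -/
def HasNoLine (n : ℕ) (Ω : Set (Fin n → ℝ)) : Prop :=
  ¬ ∃ x ∈ Ω, ∃ v : Fin n → ℝ, v ≠ 0 ∧ ∀ t : ℝ, x + t • v ∈ Ω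

/-- Ω is a properly convex affine domain. -/
def IsProperlyConvexDomain (n : ℕ) (Ω : Set (Fin n → ℝ)) : Prop :=
  IsConvexDomain n Ω ∧ HasNoLine n Ω

/-- Ω is quasi-homogeneous: some compact K ⊆ Ω has ⋃_{g ∈ Aut(Ω)} g(K) = Ω. -/
def IsQuasiHomogeneous (n : ℕ) (Ω : Set (Fin n → ℝ)) : Prop :=
  ∃ K : Set (Fin n → ℝ), IsCompact K ∧ K ⊆ Ω ∧
    (⋃ g ∈ AutSet n Ω, affAct n g '' K) = Ω

/-- Aut(Ω) is irreducible: it preserves no nonempty proper affine subspace of ℝⁿ. -/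
def IsIrreducibleAut (n : ℕ) (Ω : Set (Fin n → ℝ)) : Prop :=
  ¬ ∃ S : AffineSubspace ℝ (Fin n → ℝ), (S : Set (Fin n → ℝ)).Nonempty ∧
      (S : Set (Fin n → ℝ)) ≠ Set.univ ∧
      ∀ g ∈ AutSet n Ω, affAct n g '' (S : Set (Fin n → ℝ)) = (S : Set (Fin n → ℝ))

/-- The asymptotic cone AC(Ω). -/
def asympCone (n : ℕ) (Ω : Set (Fin n → ℝ)) : Set (Fin n → ℝ) :=
  {u | ∀ x ∈ Ω, ∀ t : ℝ, 0 ≤ t → x + t • u ∈ Ω}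

/-- Ω is a cone with some vertex v. -/
def IsCone (n : ℕ) (Ω : Set (Fin n → ℝ)) : Prop :=
  ∃ v : Fin n → ℝ, ∀ x ∈ Ω, ∀ t : ℝ, 0 < t → v + t • (x - v) ∈ Ω

/-- Two subsets of ℝⁿ are affinely equivalent. -/
def AffinelyEquivalent (n : ℕ) (Ω Ω' : Set (Fin n → ℝ)) : Prop :=
  ∃ e : (Fin n → ℝ) ≃ᵃ[ℝ] (Fin n → ℝ), e '' Ω = Ω'

/-- Γ acts freely on Ω. -/
def ActsFreely (n : ℕ) (Ω : Set (Fin n → ℝ)) (Γ : Set (GL (Fin (n + 1)) ℝ)) : Prop :=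
  ∀ γ ∈ Γ, γ ≠ 1 → ∀ x ∈ Ω, affAct n γ x ≠ x

/-- Γ acts properly discontinuously on Ω. -/
def ActsProperlyDiscontinuously (n : ℕ) (Ω : Set (Fin n → ℝ))
    (Γ : Set (GL (Fin (n + 1)) ℝ)) : Prop :=
  ∀ K L : Set (Fin n → ℝ), K ⊆ Ω → L ⊆ Ω → IsCompact K → IsCompact L →
    {γ ∈ Γ | (affAct n γ '' K ∩ L).Nonempty}.Finite

/-- Γ acts cocompactly on Ω. -/
def ActsCocompactly (n : ℕ) (Ω : Set (Fin n → ℝ)) (Γ : Set (GL (Fin (n + 1)) ℝ)) : Prop :=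
  ∃ K : Set (Fin n → ℝ), IsCompact K ∧ K ⊆ Ω ∧ (⋃ γ ∈ Γ, affAct n γ '' K) = Ω

/-- The linear part of an affine-form matrix has determinant one. -/
def LinearPartDetOne (n : ℕ) (g : GL (Fin (n + 1)) ℝ) : Prop :=
  (Matrix.of fun i j : Fin n => g.val i.castSucc j.castSucc).det = 1

section QuasiHomogeneous

variable {E : Type*} [NormedAddCommGroup E] [NormedSpace ℝ E]

/-- The recession cone of a set. -/
def recessionCone (X : Set E) : Set E := {u | ∀ x ∈ X, ∀ t : ℝ, 0 ≤ t → x + t • u ∈ X}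

namespace recessionCone

variable {X : Set E} {u v : E}

lemma zero_mem : (0 : E) ∈ recessionCone X := fun x hx t _ => by simpa using hx

lemma add_mem (hu : u ∈ recessionCone X) (hv : v ∈ recessionCone X) :
    u + v ∈ recessionCone X := fun x hx t ht => by
  have := hv _ (hu x hx t ht) t ht
  rwa [add_assoc, ← smul_add] at this

lemma smul_mem (hu : u ∈ recessionCone X) {c : ℝ} (hc : 0 ≤ c) :
    c • u ∈ recessionCone X := fun x hx t ht => by
  rw [smul_smul]; exact hu x hx _ (mul_nonneg ht hc)

lemma smul_mem_iff {c : ℝ} (hc : 0 < c) : c • u ∈ recessionCone X ↔ u ∈ recessionCone X := by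
  refine ⟨fun h => ?_, fun h => smul_mem h hc.le⟩
  simpa [smul_smul, hc.ne'] using smul_mem h (inv_nonneg.2 hc.le)

lemma add_mem_set (hu : u ∈ recessionCone X) {x : E} (hx : x ∈ X) : x + u ∈ X := by
  simpa using hu x hx 1 zero_le_one

lemma convex : Convex ℝ (recessionCone X) := fun _ hu _ hv _ _ ha hb _ =>
  add_mem (smul_mem hu ha) (smul_mem hv hb)

lemma isClosed (hX : IsClosed X) : IsClosed (recessionCone X) := by
  simp only [recessionCone, ofPred_forall]
  refine isClosed_iInter fun x => isClosed_iInter fun _ => isClosed_iInter fun t =>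
    isClosed_iInter fun _ => hX.preimage (by fun_prop)

/-- Limits of rescaled points of a closed convex set lie in its recession cone. -/
lemma mem_of_tendsto {ι : Type*} {l : Filter ι} [l.NeBot] (hX : IsClosed X) (hc : Convex ℝ X)
    {z : ι → E} {r : ι → ℝ} (hz : ∀ᶠ k in l, z k ∈ X) (hr : ∀ᶠ k in l, 0 ≤ r k)
    (hr0 : Tendsto r l (𝓝 0)) (h : Tendsto (fun k => r k • z k) l (𝓝 u)) :
    u ∈ recessionCone X := by
  intro x hx t ht
  have h1 : Tendsto (fun k => (1 - t * r k) • x + t • (r k • z k)) l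
      (𝓝 ((1 - t * 0) • x + t • u)) :=
    ((tendsto_const_nhds.sub (hr0.const_mul t)).smul tendsto_const_nhds).add (h.const_smul t)
  rw [mul_zero, sub_zero, one_smul] at h1
  refine hX.mem_of_tendsto h1 ?_
  have h2 : ∀ᶠ k in l, t * r k < 1 := by
    have : Tendsto (fun k => t * r k) l (𝓝 (t * 0)) := hr0.const_mul t
    rw [mul_zero] at this
    exact this.eventually_lt_const one_pos
  filter_upwards [hz, hr, h2] with k hk hk0 hk1
  rw [smul_smul]
  exact hc hx hk (by linarith) (mul_nonneg ht hk0) (by ring)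

end recessionCone

lemma Ultrafilter.exists_tendsto_of_norm_le {F : Type*} [NormedAddCommGroup F] [ProperSpace F]
    {ι : Type*} (U : Ultrafilter ι) {f : ι → F} {M : ℝ} (h : ∀ᶠ k in U, ‖f k‖ ≤ M) :
    ∃ a, Tendsto f U (𝓝 a) := by
  obtain ⟨a, -, ha⟩ := (isCompact_closedBall (0 : F) M).ultrafilter_le_nhds' (U.map f)
    (by
      change ∀ᶠ k in U, f k ∈ Metric.closedBall 0 M
      simpa using h)
  exact ⟨a, ha⟩

lemma closure_pointed {Ω : Set E} (ho : IsOpen Ω) (hc : Convex ℝ Ω) (hne : Ω.Nonempty)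
    (hl : ¬ ∃ x ∈ Ω, ∃ v : E, v ≠ 0 ∧ ∀ t : ℝ, x + t • v ∈ Ω) :
    ∀ u ∈ recessionCone (closure Ω), -u ∈ recessionCone (closure Ω) → u = 0 := by
  intro u hu hu'
  by_contra h0
  obtain ⟨x, hx⟩ := hne
  refine hl ⟨x, hx, u, h0, fun t => ?_⟩
  have hm : x + (2 * t) • u ∈ closure Ω := by
    rcases le_total 0 t with ht | ht
    · exact hu x (subset_closure hx) _ (by linarith)
    · simpa using hu' x (subset_closure hx) (-(2 * t)) (by linarith)
  have := hc.combo_interior_closure_mem_interior (ho.interior_eq.symm ▸ hx) hm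
    (a := 1 / 2) (b := 1 / 2) (by norm_num) (by norm_num) (by norm_num)
  rw [ho.interior_eq] at this
  convert this using 1
  module

lemma AffineEquiv.linear_sub (g : E ≃ᵃ[ℝ] E) (x y : E) : g.linear (x - y) = g x - g y := by
  simpa using g.toAffineMap.linearMap_vsub x y

lemma AffineEquiv.apply_add (g : E ≃ᵃ[ℝ] E) (x v : E) : g (x + v) = g x + g.linear v := by
  rw [← sub_eq_iff_eq_add', ← AffineEquiv.linear_sub, add_sub_cancel_left]

lemma AffineEquiv.symm_image_eq {g : E ≃ᵃ[ℝ] E} {Ω : Set E} (hg : g '' Ω = Ω) :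
    g.symm '' Ω = Ω := by
  conv_lhs => rw [← hg]
  simp [← image_comp]

lemma AffineEquiv.apply_mem {g : E ≃ᵃ[ℝ] E} {Ω : Set E} (hg : g '' Ω = Ω) {x : E} (hx : x ∈ Ω) :
    g x ∈ Ω := hg ▸ mem_image_of_mem g hx

lemma AffineEquiv.symm_apply_mem {g : E ≃ᵃ[ℝ] E} {Ω : Set E} (hg : g '' Ω = Ω) {x : E}
    (hx : x ∈ Ω) : g.symm x ∈ Ω := AffineEquiv.apply_mem (AffineEquiv.symm_image_eq hg) hx

lemma AffineEquiv.linear_mem_recessionCone {g : E ≃ᵃ[ℝ] E} {X : Set E} (hg : g '' X = X) {u : E}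
    (hu : u ∈ recessionCone X) : g.linear u ∈ recessionCone X := by
  intro x hx t ht
  have := AffineEquiv.apply_mem hg (hu _ (AffineEquiv.symm_apply_mem hg hx) t ht)
  rwa [AffineEquiv.apply_add, AffineEquiv.apply_symm_apply, map_smul] at this

lemma AffineEquiv.linear_symm_mem_recessionCone {g : E ≃ᵃ[ℝ] E} {X : Set E} (hg : g '' X = X)
    {u : E} (hu : g.linear u ∈ recessionCone X) : u ∈ recessionCone X := by
  have := AffineEquiv.linear_mem_recessionCone (AffineEquiv.symm_image_eq hg) hu
  simpa using this

/-- `K` is a compact subset of the properly convex domain `Ω` whose translates under the affine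
automorphisms of `Ω` cover `Ω`. -/
structure IsQuasiHomogeneousDomain (Ω K : Set E) : Prop where
  isOpen : IsOpen Ω
  convex : Convex ℝ Ω
  noLine : ¬ ∃ x ∈ Ω, ∃ v : E, v ≠ 0 ∧ ∀ t : ℝ, x + t • v ∈ Ω
  isCompact : IsCompact K
  subset : K ⊆ Ω
  exists_eq : ∀ x ∈ Ω, ∃ g : E ≃ᵃ[ℝ] E, g '' Ω = Ω ∧ ∃ q ∈ K, g q = x

/-- The points `w` such that the slice of `Ω` through `w` along the span of the recession cone is
contained in the translate of this cone by `w`. -/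
def coneVertices (Ω : Set E) : Set E :=
  {w | ∀ z ∈ Ω, z - w ∈ Submodule.span ℝ (recessionCone (closure Ω)) →
    z - w ∈ recessionCone (closure Ω)}

lemma isClosed_coneVertices {Ω : Set E} (ho : IsOpen Ω) : IsClosed (coneVertices Ω) := by
  refine isClosed_of_closure_subset fun w hw z hz hzw => ?_
  obtain ⟨u, hu, hlim⟩ := mem_closure_iff_seq_limit.1 hw
  have h1 : Tendsto (fun k => u k + (z - w)) atTop (𝓝 z) := by
    simpa using hlim.add_const (z - w)
  obtain ⟨k, hk⟩ := (h1.eventually_mem (ho.mem_nhds hz)).exists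
  have := hu k _ hk
  rw [add_sub_cancel_left] at this
  exact this hzw

/-- Joint continuity of the evaluation of continuous linear maps. -/
lemma tendsto_clm_apply {ι : Type*} {l : Filter ι} {f : ι → E →L[ℝ] E} {v : ι → E} {B : E →L[ℝ] E}
    {a : E} (hf : Tendsto f l (𝓝 B)) (hv : Tendsto v l (𝓝 a)) :
    Tendsto (fun k => f k (v k)) l (𝓝 (B a)) :=
  ((isBoundedBilinearMap_apply (𝕜 := ℝ) (E := E) (F := E)).continuous.tendsto (B, a)).comp
    (hf.prodMk_nhds hv)

/-- A point of a convex set is extreme iff it is the midpoint of no nontrivial segment. -/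
lemma mem_extremePoints_iff_add_sub {X : Set E} (hX : Convex ℝ X) {ξ : E} :
    ξ ∈ X.extremePoints ℝ ↔ ξ ∈ X ∧ ∀ v, ξ + v ∈ X → ξ - v ∈ X → v = 0 := by
  rw [mem_extremePoints]
  refine and_congr_right fun hξ => ⟨fun H v h1 h2 => ?_, fun H x hx y hy hxy => ?_⟩
  · have := (H _ h1 _ h2 ⟨1 / 2, 1 / 2, by norm_num, by norm_num, by norm_num, by module⟩).1
    simpa using this
  · obtain ⟨a, b, ha, hb, hab, rfl⟩ := hxy
    obtain rfl : a = 1 - b := by linarith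
    let m := min (1 - b) b
    have hm : 0 < m := lt_min ha hb
    have hm1 : m ≤ 1 - b := min_le_left _ _
    have hm2 : m ≤ b := min_le_right _ _
    have h0 := H (m • (y - x)) (by
      convert hX hx hy (a := 1 - b - m) (b := b + m) (by linarith) (by linarith) (by ring) using 1
      module) (by
      convert hX hx hy (a := 1 - b + m) (b := b - m) (by linarith) (by linarith) (by ring) using 1
      module)
    obtain rfl : y = x := sub_eq_zero.1 ((smul_eq_zero.1 h0).resolve_left hm.ne')
    constructor <;> module

namespace IsQuasiHomogeneousDomain

variable {Ω K : Set E}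

lemma combo_mem (h : IsQuasiHomogeneousDomain Ω K) {x z : E} (hx : x ∈ closure Ω) (hz : z ∈ Ω)
    {t : ℝ} (ht : 0 < t) (ht1 : t ≤ 1) : x + t • (z - x) ∈ Ω := by
  have := h.convex.combo_closure_interior_mem_interior hx (h.isOpen.interior_eq.symm ▸ hz)
    (a := 1 - t) (b := t) (by linarith) ht (by ring)
  rw [h.isOpen.interior_eq] at this
  convert this using 1
  module

/-- A sequence of points of `Ω` is, along an ultrafilter, the image under automorphisms of
a convergent sequence of points. -/
lemma exists_seq (h : IsQuasiHomogeneousDomain Ω K) (U : Ultrafilter ℕ) {x : ℕ → E}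
    (hx : ∀ k, x k ∈ Ω) : ∃ (g : ℕ → E ≃ᵃ[ℝ] E) (p : ℕ → E) (q : E), (∀ k, g k '' Ω = Ω) ∧
      (∀ k, g k (p k) = x k) ∧ (∀ k, p k ∈ Ω) ∧ Tendsto p U (𝓝 q) ∧ q ∈ Ω := by
  choose g hg p hpK hp using fun k => h.exists_eq (x k) (hx k)
  obtain ⟨q, hq, hlim⟩ := h.isCompact.ultrafilter_le_nhds' (U.map p)
    (Eventually.of_forall hpK : ∀ᶠ k in U, p k ∈ K)
  exact ⟨g, p, q, hg, hp, fun k => h.subset (hpK k), hlim, h.subset hq⟩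

lemma add_mem_of_mem_recessionCone (h : IsQuasiHomogeneousDomain Ω K) {x u : E} (hx : x ∈ Ω)
    (hu : u ∈ recessionCone (closure Ω)) : x + u ∈ Ω := by
  have := h.combo_mem (hu x (subset_closure hx) 2 zero_le_two) hx
    (t := 1 / 2) (by norm_num) (by norm_num)
  convert this using 1
  module

/-- The limit of a blow-up maps the domain into its closure. -/
lemma blowup_mem_closure {ι : Type*} {l : Filter ι} [l.NeBot] {g : ι → E ≃ᵃ[ℝ] E}
    {f : E → E} (hg : ∀ k, g k '' Ω = Ω) (hf : ∀ x, Tendsto (fun k => g k x) l (𝓝 (f x)))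
    {x : E} (hx : x ∈ Ω) : f x ∈ closure Ω :=
  isClosed_closure.mem_of_tendsto (hf x)
    (Eventually.of_forall fun k => subset_closure (AffineEquiv.apply_mem (hg k) hx))

lemma exists_add_smul_mem (h : IsQuasiHomogeneousDomain Ω K) {q : E} (hq : q ∈ Ω) (δ : E) :
    ∃ s : ℝ, 0 < s ∧ q + s • δ ∈ Ω ∧ q - s • δ ∈ Ω := by
  have h1 : Tendsto (fun s : ℝ => q + s • δ) (𝓝[>] 0) (𝓝 (q + (0 : ℝ) • δ)) :=
    (Continuous.tendsto (by fun_prop) _).mono_left nhdsWithin_le_nhds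
  have h2 : Tendsto (fun s : ℝ => q - s • δ) (𝓝[>] 0) (𝓝 (q - (0 : ℝ) • δ)) :=
    (Continuous.tendsto (by fun_prop) _).mono_left nhdsWithin_le_nhds
  rw [zero_smul, add_zero] at h1
  rw [zero_smul, sub_zero] at h2
  have hn := h.isOpen.mem_nhds hq
  have h3 : ∀ᶠ s : ℝ in 𝓝[>] 0, 0 < s := self_mem_nhdsWithin
  exact (h3.and
    ((h1.eventually_mem hn).and (h2.eventually_mem hn))).exists

/-- A limit of extreme points is extreme in the directions of the recession cone. -/
lemma eq_zero_of_sub_mem (h : IsQuasiHomogeneousDomain Ω K) (hne : Ω.Nonempty) {ξ c u : E}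
    (hξ : ξ ∈ coneVertices Ω) (hc : c ∈ recessionCone (closure Ω)) (hξc : ξ + c ∈ Ω)
    (hu : u ∈ recessionCone (closure Ω)) (hξu : ξ - u ∈ closure Ω) : u = 0 := by
  refine closure_pointed h.isOpen h.convex hne h.noLine u hu ?_
  have key : ∀ s : ℝ, 0 < s ∧ s ≤ 1 → s • c - (1 - s) • u ∈ recessionCone (closure Ω) := by
    rintro s ⟨hs, hs1⟩
    have h1 := hξ _ (h.combo_mem hξu hξc hs hs1)
    have h2 : ξ - u + s • (ξ + c - (ξ - u)) - ξ = s • c - (1 - s) • u := by module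
    rw [h2] at h1
    exact h1 (Submodule.sub_mem _ (Submodule.smul_mem _ _ (Submodule.subset_span hc))
      (Submodule.smul_mem _ _ (Submodule.subset_span hu)))
  have h1 : Tendsto (fun s : ℝ => s • c - (1 - s) • u) (𝓝[>] 0)
      (𝓝 ((0 : ℝ) • c - (1 - (0 : ℝ)) • u)) :=
    (Continuous.tendsto (by fun_prop) _).mono_left nhdsWithin_le_nhds
  rw [zero_smul, sub_zero, one_smul, zero_sub] at h1
  refine (recessionCone.isClosed isClosed_closure).mem_of_tendsto h1 ?_
  filter_upwards [Ioc_mem_nhdsGT (zero_lt_one' ℝ)] with s hs using key s hs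

end IsQuasiHomogeneousDomain

variable [FiniteDimensional ℝ E]

/-- In a closed convex set with pointed recession cone, the symmetric segments centred at points
of a bounded set have bounded length. -/
lemma exists_norm_le_of_add_sub_mem {X : Set E} (hX : IsClosed X) (hc : Convex ℝ X)
    (hp : ∀ u ∈ recessionCone X, -u ∈ recessionCone X → u = 0) (R : ℝ) :
    ∃ M : ℝ, ∀ q v : E, ‖q‖ ≤ R → q + v ∈ X → q - v ∈ X → ‖v‖ ≤ M := by
  have : ProperSpace E := FiniteDimensional.proper ℝ E
  by_contra! H
  choose q v hq h1 h2 h3 using fun k : ℕ => H ((k : ℝ) + 1)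
  let U : Ultrafilter ℕ := hyperfilter ℕ
  have hU : (U : Filter ℕ) ≤ atTop := Nat.hyperfilter_le_atTop
  have hpos : ∀ k, 0 < ‖v k‖ := fun k => lt_trans (by positivity) (h3 k)
  have hr : Tendsto (fun k => ‖v k‖⁻¹) U (𝓝 0) := by
    refine tendsto_inv_atTop_zero.comp ?_
    refine tendsto_atTop_mono (fun k => ?_) (tendsto_natCast_atTop_atTop.mono_left hU)
    linarith [h3 k]
  obtain ⟨u, hu⟩ := U.exists_tendsto_of_norm_le (f := fun k => ‖v k‖⁻¹ • v k) (M := 1)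
    (Eventually.of_forall fun k => by
      rw [norm_smul, norm_inv, norm_norm, inv_mul_cancel₀ (hpos k).ne'])
  have hu1 : ‖u‖ = 1 := by
    refine tendsto_nhds_unique hu.norm (tendsto_const_nhds.congr fun k => ?_)
    rw [norm_smul, norm_inv, norm_norm, inv_mul_cancel₀ (hpos k).ne']
  have hq0 : Tendsto (fun k => ‖v k‖⁻¹ • q k) U (𝓝 0) :=
    hr.zero_smul_isBoundedUnder_le (isBoundedUnder_of ⟨R, hq⟩)
  have hu2 : u ∈ recessionCone X := by
    refine recessionCone.mem_of_tendsto (l := (U : Filter ℕ)) hX hc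
      (Eventually.of_forall h1) (Eventually.of_forall fun k => (inv_pos.2 (hpos k)).le) hr ?_
    simpa [smul_add] using hq0.add hu
  have hu3 : -u ∈ recessionCone X := by
    refine recessionCone.mem_of_tendsto (l := (U : Filter ℕ)) hX hc
      (Eventually.of_forall h2) (Eventually.of_forall fun k => (inv_pos.2 (hpos k)).le) hr ?_
    simpa [smul_sub] using hq0.sub hu
  rw [hp u hu2 hu3, norm_zero] at hu1
  exact zero_ne_one hu1

/-- A convex cone contains a relatively open ball of its span. -/
lemma exists_ball_subset_recessionCone (X : Set E) :
    ∃ v₀ ∈ recessionCone X, ∃ r > 0, ∀ v ∈ Submodule.span ℝ (recessionCone X), ‖v‖ ≤ r →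
      v₀ + v ∈ recessionCone X := by
  set V := Submodule.span ℝ (recessionCone X)
  let S : Set V := (↑) ⁻¹' recessionCone X
  have hS : Convex ℝ S := recessionCone.convex.linear_preimage V.subtype
  have hspan : affineSpan ℝ S = ⊤ := by
    have h0 : (0 : V) ∈ S := recessionCone.zero_mem
    have h1 : Submodule.span ℝ S = ⊤ := Submodule.span_span_coe_preimage
    have h2 : (affineSpan ℝ (insert 0 S) : Set V) = Submodule.span ℝ S := affineSpan_insert_zero ..
    rw [insert_eq_of_mem h0, h1] at h2
    exact SetLike.coe_injective (by simpa using h2)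
  obtain ⟨v, hv⟩ := hS.interior_nonempty_iff_affineSpan_eq_top.2 hspan
  obtain ⟨r, hr, hb⟩ := Metric.mem_nhds_iff.1 (mem_interior_iff_mem_nhds.1 hv)
  refine ⟨v, (interior_subset hv : v ∈ S), r / 2, by positivity, fun x hx hxr => ?_⟩
  have : v + ⟨x, hx⟩ ∈ S := hb (by
    rw [Metric.mem_ball, dist_eq_norm, add_sub_cancel_left, Submodule.coe_norm]
    change ‖x‖ < r
    linarith)
  exact this

lemma AffineEquiv.image_closure_eq {g : E ≃ᵃ[ℝ] E} {Ω : Set E} (hg : g '' Ω = Ω) :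
    g '' closure Ω = closure Ω := by
  have := g.toContinuousAffineEquiv.toHomeomorph.image_closure Ω
  change g '' closure Ω = closure (g '' Ω) at this
  rwa [hg] at this

/-- The linear part of an affine automorphism, as a continuous linear map. -/
def linearCLM (g : E ≃ᵃ[ℝ] E) : E →L[ℝ] E := LinearMap.toContinuousLinearMap (g.linear : E →ₗ[ℝ] E)

@[simp] lemma linearCLM_apply (g : E ≃ᵃ[ℝ] E) (v : E) : linearCLM g v = g.linear v := rfl

lemma apply_mem_coneVertices {Ω : Set E} {g : E ≃ᵃ[ℝ] E} (hg : g '' Ω = Ω) {w : E}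
    (hw : w ∈ coneVertices Ω) : g w ∈ coneVertices Ω := by
  intro z hz hzw
  have hgX := AffineEquiv.image_closure_eq hg
  have h1 : ∀ v ∈ Submodule.span ℝ (recessionCone (closure Ω)),
      g.symm.linear v ∈ Submodule.span ℝ (recessionCone (closure Ω)) := by
    intro v hv
    have := Submodule.mem_map_of_mem (f := (g.symm.linear : E →ₗ[ℝ] E)) hv
    rw [Submodule.map_span] at this
    refine Submodule.span_mono ?_ this
    rintro _ ⟨u, hu, rfl⟩
    exact AffineEquiv.linear_mem_recessionCone (AffineEquiv.symm_image_eq hgX) hu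
  have h2 : g.symm.linear (z - g w) = g.symm z - w := by
    rw [AffineEquiv.linear_sub, AffineEquiv.symm_apply_apply]
  have h3 := hw (g.symm z) (AffineEquiv.symm_apply_mem hg hz) (h2 ▸ h1 _ hzw)
  have h4 := AffineEquiv.linear_mem_recessionCone hgX h3
  rwa [AffineEquiv.linear_sub, AffineEquiv.apply_symm_apply] at h4

namespace IsQuasiHomogeneousDomain

variable {Ω K : Set E}

lemma exists_norm_le (h : IsQuasiHomogeneousDomain Ω K) (R : ℝ) :
    ∃ M : ℝ, ∀ q v : E, ‖q‖ ≤ R → q + v ∈ closure Ω → q - v ∈ closure Ω → ‖v‖ ≤ M := by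
  rcases Ω.eq_empty_or_nonempty with rfl | hne
  · exact ⟨0, by simp⟩
  exact exists_norm_le_of_add_sub_mem isClosed_closure h.convex.closure
    (closure_pointed h.isOpen h.convex hne h.noLine) R

/-- If a convergent sequence has bounded image under automorphisms, the linear parts converge along
an ultrafilter. -/
lemma exists_tendsto_linear (h : IsQuasiHomogeneousDomain Ω K) (U : Ultrafilter ℕ)
    {g : ℕ → E ≃ᵃ[ℝ] E} (hg : ∀ k, g k '' Ω = Ω) {p : ℕ → E} {q ξ : E} (hp : Tendsto p U (𝓝 q))
    (hq : q ∈ Ω) (hξ : Tendsto (fun k => g k (p k)) U (𝓝 ξ)) :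
    ∃ B : E →L[ℝ] E, Tendsto (fun k => linearCLM (g k)) U (𝓝 B) := by
  obtain ⟨r, hr, hb⟩ := Metric.isOpen_iff.1 h.isOpen q hq
  obtain ⟨M, hM⟩ := h.exists_norm_le (‖ξ‖ + 1)
  have hM0 : 0 ≤ max M 0 := le_max_right _ _
  have hs : ∀ᶠ k in (U : Filter ℕ), ‖linearCLM (g k)‖ ≤ max M 0 / (r / 4) := by
    have e1 : ∀ᶠ k in (U : Filter ℕ), ‖g k (p k)‖ < ‖ξ‖ + 1 :=
      hξ.norm.eventually_lt_const (by linarith)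
    have e2 : ∀ᶠ k in (U : Filter ℕ), p k ∈ Metric.ball q (r / 2) :=
      hp.eventually_mem (Metric.ball_mem_nhds q (by positivity))
    filter_upwards [e1, e2] with k h1 h2
    have key : ∀ v : E, ‖v‖ < r / 2 → ‖linearCLM (g k) v‖ ≤ max M 0 := by
      intro v hv
      have hmem : ∀ w : E, ‖w‖ < r / 2 → g k (p k) + (g k).linear w ∈ closure Ω := by
        intro w hw
        rw [← AffineEquiv.apply_add]
        refine subset_closure (AffineEquiv.apply_mem (hg k) (hb ?_))
        rw [mem_ball_iff_norm] at h2 ⊢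
        calc ‖p k + w - q‖ = ‖(p k - q) + w‖ := by congr 1; abel
          _ ≤ ‖p k - q‖ + ‖w‖ := norm_add_le _ _
          _ < r := by linarith
      refine (hM _ _ h1.le (hmem v hv) ?_).trans (le_max_left _ _)
      have := hmem (-v) (by simpa using hv)
      rwa [map_neg, ← sub_eq_add_neg] at this
    refine ContinuousLinearMap.opNorm_le_of_unit_norm (by positivity) fun v hv => ?_
    have h3 := key ((r / 4) • v) (by
      rw [norm_smul, hv, Real.norm_of_nonneg (by positivity)]
      linarith)
    rw [map_smul, norm_smul, Real.norm_of_nonneg (by positivity)] at h3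
    rwa [le_div_iff₀' (by positivity)]
  have : ProperSpace (E →L[ℝ] E) := FiniteDimensional.proper ℝ _
  exact U.exists_tendsto_of_norm_le hs

/-- Blowing up the domain at a point `ξ` of its closure. -/
lemma exists_blowup (h : IsQuasiHomogeneousDomain Ω K) (hne : Ω.Nonempty) (U : Ultrafilter ℕ)
    (hU : (U : Filter ℕ) ≤ atTop) {ξ : E} (hξ : ξ ∈ closure Ω) :
    ∃ (g : ℕ → E ≃ᵃ[ℝ] E) (w : ℕ → E) (q w₀ : E) (B : E →L[ℝ] E), (∀ k, g k '' Ω = Ω) ∧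
      (∀ k, g k (w k) = ξ) ∧ Tendsto w U (𝓝 w₀) ∧ q ∈ Ω ∧
      q - w₀ ∈ recessionCone (closure Ω) ∧ Tendsto (fun k => linearCLM (g k)) U (𝓝 B) ∧
      ∀ x : E, Tendsto (fun k => g k x) U (𝓝 (ξ + B (x - q))) := by
  obtain ⟨z, hz⟩ := hne
  let t : ℕ → ℝ := fun k => 1 / ((k : ℝ) + 2)
  have ht0 : ∀ k, 0 < t k := fun k => by positivity
  have ht2 : ∀ k, 2 * t k ≤ 1 := fun k => by
    rw [← le_div_iff₀' (by norm_num)]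
    exact one_div_le_one_div_of_le (by norm_num) (by linarith [Nat.cast_nonneg (α := ℝ) k])
  have htlim : Tendsto t U (𝓝 0) := by
    have h1 : Tendsto (fun k : ℕ => (k : ℝ) + 2) atTop atTop :=
      tendsto_atTop_add_const_right _ _ tendsto_natCast_atTop_atTop
    simpa [t, Function.comp_def] using (tendsto_inv_atTop_zero.comp h1).mono_left hU
  obtain ⟨g, p, q, hg, hgp, -, hp, hq⟩ := h.exists_seq U (x := fun k => ξ + t k • (z - ξ))
    fun k => h.combo_mem hξ hz (ht0 k) (by linarith [ht0 k, ht2 k])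
  have hgX := fun k => AffineEquiv.image_closure_eq (hg k)
  let w : ℕ → E := fun k => (g k).symm ξ
  have hgw : ∀ k, g k (w k) = ξ := fun k => (g k).apply_symm_apply ξ
  have hw : ∀ k, w k ∈ closure Ω := fun k => AffineEquiv.symm_apply_mem (hgX k) hξ
  have hlin : ∀ k, (g k).linear (p k - w k) = t k • (z - ξ) := fun k => by
    rw [AffineEquiv.linear_sub, hgp, hgw, add_sub_cancel_left]
  have hray : ∀ k s, 0 < s → s * t k ≤ 1 → w k + s • (p k - w k) ∈ closure Ω := by
    intro k s hs hst
    have h1 := AffineEquiv.symm_apply_mem (hgX k)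
      (subset_closure (h.combo_mem hξ hz (mul_pos hs (ht0 k)) hst))
    convert h1 using 1
    rw [AffineEquiv.eq_symm_apply, AffineEquiv.apply_add, map_smul, hlin, hgw, smul_smul]
  obtain ⟨M, hM⟩ := h.exists_norm_le (‖q‖ + 1)
  have hbd : ∀ᶠ k in (U : Filter ℕ), ‖p k - w k‖ ≤ M := by
    have e1 : ∀ᶠ k in (U : Filter ℕ), ‖p k‖ < ‖q‖ + 1 :=
      hp.norm.eventually_lt_const (by linarith)
    filter_upwards [e1] with k hk
    refine hM (p k) _ hk.le ?_ (by simpa using hw k)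
    convert hray k 2 two_pos (ht2 k) using 1
    module
  have : ProperSpace E := FiniteDimensional.proper ℝ E
  obtain ⟨c, hc⟩ := U.exists_tendsto_of_norm_le hbd
  have hww : Tendsto w U (𝓝 (q - c)) := by simpa using hp.sub hc
  have hcC : c ∈ recessionCone (closure Ω) := by
    refine recessionCone.mem_of_tendsto (l := (U : Filter ℕ)) isClosed_closure h.convex.closure
      (z := fun k => w k + (t k)⁻¹ • (p k - w k)) (r := t)
      (Eventually.of_forall fun k => hray k _ (inv_pos.2 (ht0 k))
        (inv_mul_cancel₀ (ht0 k).ne').le)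
      (Eventually.of_forall fun k => (ht0 k).le) htlim ?_
    have h1 : Tendsto (fun k => t k • w k + (p k - w k)) U (𝓝 ((0 : ℝ) • (q - c) + c)) :=
      (htlim.smul hww).add hc
    rw [zero_smul, zero_add] at h1
    refine h1.congr fun k => ?_
    rw [smul_add, smul_smul, mul_inv_cancel₀ (ht0 k).ne', one_smul]
  have hgplim : Tendsto (fun k => g k (p k)) U (𝓝 ξ) := by
    have h1 : Tendsto (fun k => ξ + t k • (z - ξ)) U (𝓝 (ξ + (0 : ℝ) • (z - ξ))) :=
      tendsto_const_nhds.add (htlim.smul_const _)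
    rw [zero_smul, add_zero] at h1
    exact h1.congr fun k => (hgp k).symm
  obtain ⟨B, hB⟩ := h.exists_tendsto_linear U hg hp hq hgplim
  refine ⟨g, w, q, q - c, B, hg, hgw, hww, hq, by simpa using hcC, hB, fun x => ?_⟩
  have h1 : Tendsto (fun k => g k (p k) + linearCLM (g k) (x - p k)) U (𝓝 (ξ + B (x - q))) :=
    hgplim.add (tendsto_clm_apply hB (tendsto_const_nhds.sub hp))
  refine h1.congr fun k => ?_
  rw [linearCLM_apply, ← AffineEquiv.apply_add, add_sub_cancel]

/-- A quasi-homogeneous domain has a point in `coneVertices`: a limit of a fixed point under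
automorphisms pulling back a ray interior to the recession cone. -/
lemma coneVertices_nonempty (h : IsQuasiHomogeneousDomain Ω K) (hne : Ω.Nonempty) :
    (coneVertices Ω).Nonempty := by
  obtain ⟨y₀, hy₀⟩ := hne
  obtain ⟨v₀, hv₀, r, hr, hball⟩ := exists_ball_subset_recessionCone (closure Ω)
  set C := recessionCone (closure Ω)
  have hCc : IsClosed C := recessionCone.isClosed isClosed_closure
  have : ProperSpace E := FiniteDimensional.proper ℝ E
  let U : Ultrafilter ℕ := hyperfilter ℕ
  have hU : (U : Filter ℕ) ≤ atTop := Nat.hyperfilter_le_atTop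
  let T : ℕ → ℝ := fun k => (k : ℝ) + 1
  have hT : ∀ k, 0 < T k := fun k => by positivity
  have hT1 : ∀ k, (T k)⁻¹ ≤ 1 := fun k => inv_le_one_of_one_le₀ (by simp [T])
  have hTlim : Tendsto (fun k => (T k)⁻¹) U (𝓝 0) :=
    (tendsto_inv_atTop_zero.comp
      (tendsto_atTop_add_const_right _ _ tendsto_natCast_atTop_atTop)).mono_left hU
  obtain ⟨g, p, q, hg, hgp, hpΩ, hp, hq⟩ := h.exists_seq U (x := fun k => y₀ + T k • v₀)
    fun k => h.add_mem_of_mem_recessionCone hy₀ (recessionCone.smul_mem hv₀ (hT k).le)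
  have hgX := fun k => AffineEquiv.image_closure_eq (hg k)
  let y : ℕ → E := fun k => (g k).symm y₀
  have hgy : ∀ k, g k (y k) = y₀ := fun k => (g k).apply_symm_apply y₀
  have hy : ∀ k, y k ∈ Ω := fun k => AffineEquiv.symm_apply_mem (hg k) hy₀
  let c : ℕ → E := fun k => p k - y k
  have hlin : ∀ k, (g k).linear (c k) = T k • v₀ := fun k => by
    rw [AffineEquiv.linear_sub, hgp, hgy, add_sub_cancel_left]
  have hcC : ∀ k, c k ∈ C := fun k => AffineEquiv.linear_symm_mem_recessionCone (hgX k)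
    (hlin k ▸ recessionCone.smul_mem hv₀ (hT k).le)
  obtain ⟨M, hM⟩ := h.exists_norm_le (‖q‖ + 1)
  obtain ⟨a, ha⟩ : ∃ a, Tendsto c U (𝓝 a) := by
    refine U.exists_tendsto_of_norm_le (M := M) ?_
    filter_upwards [hp.norm.eventually_lt_const (lt_add_one ‖q‖)] with k hk
    refine hM (p k) _ hk.le (recessionCone.add_mem_set (hcC k) (subset_closure (hpΩ k))) ?_
    simpa [c] using subset_closure (hy k)
  have hylim : Tendsto y U (𝓝 (q - a)) := by simpa [c] using hp.sub ha
  have claim : ∀ z ∈ Ω, q - z ∈ C → z - (q - a) ∈ C := by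
    intro z hz hqz
    let z' : ℕ → E := fun k => p k - (q - z)
    have hz' : Tendsto z' U (𝓝 z) := by simpa using hp.sub_const (q - z)
    have hz'Ω : ∀ᶠ k in (U : Filter ℕ), z' k ∈ Ω := hz'.eventually_mem (h.isOpen.mem_nhds hz)
    let d : ℕ → E := fun k => (T k)⁻¹ • (g k (z' k) - y₀)
    have hTd : ∀ k, T k • d k = (g k).linear (z' k - y k) := fun k => by
      rw [smul_inv_smul₀ (hT k).ne', AffineEquiv.linear_sub, hgy]
    let e : ℕ → E := fun k => (T k)⁻¹ • (g k).linear (q - z)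
    have heC : ∀ k, e k ∈ C := fun k => recessionCone.smul_mem
      (AffineEquiv.linear_mem_recessionCone (hgX k) hqz) (inv_pos.2 (hT k)).le
    have hde : ∀ k, v₀ - e k = d k := fun k => by
      have h1 : T k • (v₀ - e k) = T k • d k := by
        rw [hTd, smul_sub, ← hlin, smul_inv_smul₀ (hT k).ne', ← map_sub]
        congr 1
        simp only [c, z']
        abel
      exact smul_right_injective E (hT k).ne' h1
    obtain ⟨N, hN⟩ := h.exists_norm_le ‖y₀ + v₀‖
    obtain ⟨b, hb⟩ : ∃ b, Tendsto e U (𝓝 b) := by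
      refine U.exists_tendsto_of_norm_le (M := N) ?_
      filter_upwards [hz'Ω] with k hk
      refine hN (y₀ + v₀) _ le_rfl (recessionCone.add_mem_set (heC k)
        (recessionCone.add_mem_set hv₀ (subset_closure hy₀))) ?_
      rw [add_sub_assoc, hde]
      exact subset_closure (h.combo_mem (subset_closure hy₀) (AffineEquiv.apply_mem (hg k) hk)
        (inv_pos.2 (hT k)) (hT1 k))
    have hd : Tendsto d U (𝓝 (v₀ - b)) := (tendsto_const_nhds.sub hb).congr hde
    have hbC : b ∈ C := hCc.mem_of_tendsto hb (Eventually.of_forall heC)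
    have hdC : v₀ - b ∈ C := by
      refine recessionCone.mem_of_tendsto (l := (U : Filter ℕ)) isClosed_closure
        h.convex.closure (z := fun k => g k (z' k)) (r := fun k => (T k)⁻¹)
        (hz'Ω.mono fun k hk => subset_closure (AffineEquiv.apply_mem (hg k) hk))
        (Eventually.of_forall fun k => (inv_pos.2 (hT k)).le) hTlim ?_
      have h1 := hd.add (hTlim.smul_const y₀)
      rw [zero_smul, add_zero] at h1
      refine h1.congr fun k => ?_
      rw [← smul_add, sub_add_cancel]
    have hε : ∀ ε : ℝ, 0 < ε → z - (q - a) + ε • a ∈ C := by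
      intro ε hε
      have hsmall : ∀ᶠ k in (U : Filter ℕ), ‖b - e k‖ < ε * r := by
        have h1 : Tendsto (fun k => ‖b - e k‖) U (𝓝 0) := by
          simpa using (tendsto_const_nhds (x := b)).sub hb |>.norm
        exact h1.eventually_lt_const (by positivity)
      refine hCc.mem_of_tendsto ((hz'.sub hylim).add (ha.const_smul ε)) ?_
      filter_upwards [hsmall] with k hk
      have h1 : v₀ + ε⁻¹ • (b - e k) ∈ C := by
        refine hball _ (Submodule.smul_mem _ _ (Submodule.sub_mem _
          (Submodule.subset_span hbC) (Submodule.subset_span (heC k)))) ?_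
        rw [norm_smul, Real.norm_of_nonneg (inv_pos.2 hε).le, inv_mul_le_iff₀ hε]
        exact hk.le
      have h2 : d k + ε • v₀ ∈ C := by
        have := recessionCone.add_mem hdC (recessionCone.smul_mem h1 hε.le)
        rw [smul_add, smul_inv_smul₀ hε.ne'] at this
        convert this using 1
        rw [← hde]
        abel
      refine AffineEquiv.linear_symm_mem_recessionCone (hgX k) ?_
      rw [map_add, map_smul, hlin, ← hTd, smul_comm ε, ← smul_add]
      exact recessionCone.smul_mem h2 (hT k).le
    have h1 : Tendsto (fun ε : ℝ => z - (q - a) + ε • a) (𝓝[>] 0)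
        (𝓝 (z - (q - a) + (0 : ℝ) • a)) :=
      (Continuous.tendsto (by fun_prop) _).mono_left nhdsWithin_le_nhds
    rw [zero_smul, add_zero] at h1
    exact hCc.mem_of_tendsto h1 (eventually_nhdsWithin_of_forall hε)
  refine ⟨q - a, fun z hz hzV => ?_⟩
  have hYX : q - a ∈ closure Ω :=
    isClosed_closure.mem_of_tendsto hylim (Eventually.of_forall fun k => subset_closure (hy k))
  obtain ⟨δ, hδΩ, hδ⟩ : ∃ δ : ℝ, q - δ • v₀ ∈ Ω ∧ 0 < δ := by
    have h1 : Tendsto (fun δ : ℝ => q - δ • v₀) (𝓝[>] 0) (𝓝 (q - (0 : ℝ) • v₀)) :=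
      (Continuous.tendsto (by fun_prop) _).mono_left nhdsWithin_le_nhds
    rw [zero_smul, sub_zero] at h1
    exact ((h1.eventually_mem (h.isOpen.mem_nhds hq)).and self_mem_nhdsWithin).exists
  have hδC : a - δ • v₀ ∈ C := by
    have := claim _ hδΩ (by simpa using recessionCone.smul_mem hv₀ hδ.le)
    convert this using 1
    abel
  let v := z - (q - a)
  let s : ℝ := min 1 (δ * r / (‖v‖ + 1))
  have hs : 0 < s := lt_min one_pos (by positivity)
  have hsv : s * ‖v‖ ≤ δ * r := by
    have h1 : s * (‖v‖ + 1) ≤ δ * r := by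
      rw [← le_div_iff₀ (by positivity)]
      exact min_le_right _ _
    nlinarith
  have hm := claim _ (h.combo_mem hYX hz hs (min_le_left _ _)) (by
    have h1 : v₀ + (-(δ⁻¹ * s)) • v ∈ C := by
      refine hball _ (Submodule.smul_mem _ _ hzV) ?_
      rw [norm_smul, norm_neg, Real.norm_of_nonneg (by positivity), mul_assoc,
        inv_mul_le_iff₀ hδ]
      exact hsv
    have h2 := recessionCone.add_mem hδC (recessionCone.smul_mem h1 hδ.le)
    convert h2 using 1
    rw [smul_add, smul_smul, mul_neg, mul_inv_cancel_left₀ hδ.ne']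
    module)
  rw [add_sub_cancel_left] at hm
  exact (recessionCone.smul_mem_iff hs).1 hm

/-- At an extreme point, the linear parts of the blow-up tend to zero. -/
lemma exists_tendsto_zero (h : IsQuasiHomogeneousDomain Ω K) (hne : Ω.Nonempty) (U : Ultrafilter ℕ)
    (hU : (U : Filter ℕ) ≤ atTop) {ξ : E} (hξ : ξ ∈ (closure Ω).extremePoints ℝ) :
    ∃ g : ℕ → E ≃ᵃ[ℝ] E, (∀ k, g k '' Ω = Ω) ∧ Tendsto (fun k => linearCLM (g k)) U (𝓝 0) ∧
      ∀ x : E, Tendsto (fun k => g k x) U (𝓝 ξ) := by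
  obtain ⟨hξX, hξe⟩ := (mem_extremePoints_iff_add_sub h.convex.closure).1 hξ
  obtain ⟨g, -, q, -, B, hg, -, -, hq, -, hB, hlim⟩ := h.exists_blowup hne U hU hξX
  have hB0 : B = 0 := by
    ext δ
    obtain ⟨s, hs, h1, h2⟩ := h.exists_add_smul_mem hq δ
    have e1 := blowup_mem_closure hg hlim h1
    have e2 := blowup_mem_closure hg hlim h2
    rw [add_sub_cancel_left, map_smul] at e1
    rw [sub_sub_cancel_left, map_neg, map_smul, ← sub_eq_add_neg] at e2
    simpa using (smul_eq_zero.1 (hξe _ e1 e2)).resolve_left hs.ne'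
  subst hB0
  exact ⟨g, hg, hB, by simpa using hlim⟩

lemma closure_extremePoints_subset (h : IsQuasiHomogeneousDomain Ω K) (hne : Ω.Nonempty) :
    closure ((closure Ω).extremePoints ℝ) ⊆ coneVertices Ω := by
  refine closure_minimal (fun ξ hξ => ?_) (isClosed_coneVertices h.isOpen)
  obtain ⟨g, hg, -, hlim⟩ :=
    h.exists_tendsto_zero hne (hyperfilter ℕ) Nat.hyperfilter_le_atTop hξ
  obtain ⟨y, hy⟩ := h.coneVertices_nonempty hne
  exact (isClosed_coneVertices h.isOpen).mem_of_tendsto (hlim y)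
    (Eventually.of_forall fun k => apply_mem_coneVertices (hg k) hy)

/-- If the closure has an extreme point then every vector is a difference of points of `Ω`. -/
lemma exists_add_mem (h : IsQuasiHomogeneousDomain Ω K) (hne : Ω.Nonempty)
    (hext : ((closure Ω).extremePoints ℝ).Nonempty) (η : E) : ∃ p ∈ Ω, p + η ∈ Ω := by
  obtain ⟨ξ, hξ⟩ := hext
  obtain ⟨g, hg, hB, -⟩ :=
    h.exists_tendsto_zero hne (hyperfilter ℕ) Nat.hyperfilter_le_atTop hξ
  obtain ⟨z, hz⟩ := hne
  have h1 : Tendsto (fun k => z + linearCLM (g k) η) (hyperfilter ℕ : Filter ℕ) (𝓝 z) := by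
    simpa using (tendsto_clm_apply hB tendsto_const_nhds).const_add z
  obtain ⟨k, hk⟩ := (h1.eventually_mem (h.isOpen.mem_nhds hz)).exists
  refine ⟨(g k).symm z, AffineEquiv.symm_apply_mem (hg k) hz, ?_⟩
  convert AffineEquiv.symm_apply_mem (hg k) hk using 1
  rw [AffineEquiv.eq_symm_apply, AffineEquiv.apply_add, AffineEquiv.apply_symm_apply,
    linearCLM_apply]

/-- The extreme points of the closure of a quasi-homogeneous domain form a closed set. -/
theorem isClosed_extremePoints (h : IsQuasiHomogeneousDomain Ω K) :
    IsClosed ((closure Ω).extremePoints ℝ) := by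
  rcases Ω.eq_empty_or_nonempty with rfl | hne
  · simp
  refine isClosed_of_closure_subset fun ξ hξ => ?_
  have hext : ((closure Ω).extremePoints ℝ).Nonempty := closure_nonempty_iff.1 ⟨ξ, hξ⟩
  have hξX : ξ ∈ closure Ω := closure_minimal extremePoints_subset isClosed_closure hξ
  have hξV := h.closure_extremePoints_subset hne hξ
  have : ProperSpace E := FiniteDimensional.proper ℝ E
  let U : Ultrafilter ℕ := hyperfilter ℕ
  obtain ⟨g, w, q, w₀, B, hg, hgw, hw, hq, hc, hB, hlim⟩ :=
    h.exists_blowup hne U Nat.hyperfilter_le_atTop hξX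
  have hgX := fun k => AffineEquiv.image_closure_eq (hg k)
  obtain ⟨c, hcC, hξc⟩ : ∃ c ∈ recessionCone (closure Ω), ξ + c ∈ Ω := by
    have h1 : Tendsto (fun k => w k + (q - w₀)) U (𝓝 q) := by
      simpa using hw.add_const (q - w₀)
    obtain ⟨k, hk⟩ := (h1.eventually_mem (h.isOpen.mem_nhds hq)).exists
    refine ⟨(g k).linear (q - w₀), AffineEquiv.linear_mem_recessionCone (hgX k) hc, ?_⟩
    rw [← hgw k, ← AffineEquiv.apply_add]
    exact AffineEquiv.apply_mem (hg k) hk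
  have hBX : ∀ x ∈ Ω, ξ + B (x - q) ∈ closure Ω := fun x hx => blowup_mem_closure hg hlim hx
  have hbd : ∃ M : ℝ, ∀ x ∈ Ω, ‖B (x - q)‖ ≤ M := by
    by_contra! H
    choose x hx hM using fun k : ℕ => H ((k : ℝ) + 1)
    have hpos : ∀ k, 0 < ‖B (x k - q)‖ := fun k => lt_trans (by positivity) (hM k)
    have hr : Tendsto (fun k => ‖B (x k - q)‖⁻¹) U (𝓝 0) := by
      refine tendsto_inv_atTop_zero.comp ?_
      refine tendsto_atTop_mono (fun k => ?_)
        (tendsto_natCast_atTop_atTop.mono_left Nat.hyperfilter_le_atTop)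
      linarith [hM k]
    have hnorm : ∀ k, ‖‖B (x k - q)‖⁻¹ • B (x k - q)‖ = 1 := fun k => by
      rw [norm_smul, norm_inv, norm_norm, inv_mul_cancel₀ (hpos k).ne']
    obtain ⟨u, hu⟩ := U.exists_tendsto_of_norm_le
      (f := fun k => ‖B (x k - q)‖⁻¹ • B (x k - q)) (M := 1)
      (Eventually.of_forall fun k => (hnorm k).le)
    have hu1 : ‖u‖ = 1 :=
      tendsto_nhds_unique hu.norm (tendsto_const_nhds.congr fun k => (hnorm k).symm)
    have huC : u ∈ recessionCone (closure Ω) := by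
      refine recessionCone.mem_of_tendsto (l := (U : Filter ℕ)) isClosed_closure h.convex.closure
        (Eventually.of_forall fun k => hBX _ (hx k))
        (Eventually.of_forall fun k => (inv_pos.2 (hpos k)).le) hr ?_
      simpa [smul_add] using (hr.smul_const ξ).add hu
    obtain ⟨δ, rfl⟩ : u ∈ LinearMap.range (B : E →ₗ[ℝ] E) :=
      (LinearMap.range (B : E →ₗ[ℝ] E)).closed_of_finiteDimensional.mem_of_tendsto hu
        (Eventually.of_forall fun k => ⟨‖B (x k - q)‖⁻¹ • (x k - q), by simp⟩)
    obtain ⟨s, hs, -, h2⟩ := h.exists_add_smul_mem hq δ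
    have e2 := hBX _ h2
    rw [sub_sub_cancel_left, map_neg, map_smul, ← sub_eq_add_neg] at e2
    have := h.eq_zero_of_sub_mem hne hξV hcC hξc (recessionCone.smul_mem huC hs.le) e2
    rw [(smul_eq_zero.1 this).resolve_left hs.ne', norm_zero] at hu1
    exact zero_ne_one hu1
  obtain ⟨M, hM⟩ := hbd
  have hB2 : ∀ η, ‖B η‖ ≤ M + M := fun η => by
    obtain ⟨p, hp, hpη⟩ := h.exists_add_mem hne hext η
    have h1 : B η = B (p + η - q) - B (p - q) := by
      rw [← map_sub]
      congr 1
      abel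
    rw [h1]
    exact (norm_sub_le _ _).trans (add_le_add (hM _ hpη) (hM _ hp))
  have hB0 : B = 0 := by
    ext η
    by_contra hη
    have hη' : 0 < ‖B η‖ := norm_pos_iff.2 hη
    have h1 := hB2 (((M + M + 1) / ‖B η‖) • η)
    have hM0 : 0 ≤ M + M := (norm_nonneg _).trans (hB2 0)
    rw [map_smul, norm_smul, Real.norm_of_nonneg (by positivity), div_mul_cancel₀ _ hη'.ne'] at h1
    linarith
  subst hB0
  refine (mem_extremePoints_iff_add_sub h.convex.closure).2 ⟨hξX, fun v h1 h2 => ?_⟩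
  let v' : ℕ → E := fun k => (g k).symm.linear v
  have hgv : ∀ k, linearCLM (g k) (v' k) = v := fun k => by simp [v']
  obtain ⟨N, hN⟩ := h.exists_norm_le (‖w₀‖ + 1)
  obtain ⟨a, ha⟩ : ∃ a, Tendsto v' U (𝓝 a) := by
    refine U.exists_tendsto_of_norm_le (M := N) ?_
    filter_upwards [hw.norm.eventually_lt_const (lt_add_one ‖w₀‖)] with k hk
    refine hN (w k) _ hk.le ?_ ?_
    · convert AffineEquiv.symm_apply_mem (hgX k) h1 using 1
      rw [AffineEquiv.apply_add, ← hgw k, AffineEquiv.symm_apply_apply]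
    · convert AffineEquiv.symm_apply_mem (hgX k) h2 using 1
      rw [sub_eq_add_neg ξ, AffineEquiv.apply_add, ← hgw k, AffineEquiv.symm_apply_apply, map_neg,
        ← sub_eq_add_neg]
  simpa using tendsto_nhds_unique (tendsto_const_nhds.congr fun k => (hgv k).symm)
    (tendsto_clm_apply hB ha)

end IsQuasiHomogeneousDomain

end QuasiHomogeneous

/-- A matrix in affine form acts as an affine automorphism of `ℝⁿ`. -/
lemma exists_affineEquiv_eq_affAct {n : ℕ} {g : GL (Fin (n + 1)) ℝ} (hg : IsAffineForm n g) :
    ∃ e : (Fin n → ℝ) ≃ᵃ[ℝ] (Fin n → ℝ), ⇑e = affAct n g := by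
  let A : Matrix (Fin n) (Fin n) ℝ := of fun i j => g.val i.castSucc j.castSucc
  have hinj : Function.Injective A.mulVecLin := by
    rw [← LinearMap.ker_eq_bot, LinearMap.ker_eq_bot']
    intro v hv
    have h1 : g.val *ᵥ (Fin.snoc v 0 : Fin (n + 1) → ℝ) = 0 := by
      ext i
      simp only [mulVec, dotProduct, Fin.sum_univ_castSucc, Fin.snoc_castSucc, Fin.snoc_last,
        mul_zero, add_zero, Pi.zero_apply]
      refine Fin.lastCases ?_ (fun i => ?_) i
      · simp [hg.1]
      · simpa [A, mulVec, dotProduct] using congr_fun hv i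
    have h2 : (Fin.snoc v 0 : Fin (n + 1) → ℝ) = 0 := by
      have : g⁻¹.val *ᵥ (g.val *ᵥ (Fin.snoc v 0 : Fin (n + 1) → ℝ)) = 0 := by
        rw [h1, mulVec_zero]
      rwa [mulVec_mulVec, ← Units.val_mul, inv_mul_cancel, Units.val_one, one_mulVec] at this
    ext i
    simpa using congr_fun h2 i.castSucc
  let b : Fin n → ℝ := fun i => g.val i.castSucc (Fin.last n)
  refine ⟨(LinearEquiv.ofInjectiveEndo A.mulVecLin hinj).toAffineEquiv.trans
    (AffineEquiv.constVAdd ℝ (Fin n → ℝ) b), ?_⟩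
  ext x i
  simp [affAct, A, b, mulVec, dotProduct, add_comm]

/-- for a properly convex quasi-homogeneous affine domain, the set of
extreme points of the closure is closed. -/
theorem extremePoints_isClosed (n : ℕ) (Ω : Set (Fin n → ℝ))
    (h1 : IsProperlyConvexDomain n Ω) (h2 : IsQuasiHomogeneous n Ω) :
    IsClosed (Set.extremePoints ℝ (closure Ω)) := by
  obtain ⟨K, hK, hKΩ, hcov⟩ := h2
  have h : IsQuasiHomogeneousDomain Ω K := by
    refine ⟨h1.1.2.1, h1.1.2.2, h1.2, hK, hKΩ, fun x hx => ?_⟩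
    rw [← hcov, mem_iUnion₂] at hx
    obtain ⟨g, ⟨hg, hgΩ⟩, q, hq, rfl⟩ := hx
    obtain ⟨e, he⟩ := exists_affineEquiv_eq_affAct hg
    exact ⟨e, he ▸ hgΩ, q, hq, by rw [he]⟩
  exact h.isClosed_extremePoints
end
end

section
/- Let Ω be a quasi-homogeneous properly convex affine domain in ℝⁿ and let ξ be an extreme point of the closure of Ω. Then (ξ + AC(Ω)) ∩ Ω = ξ + AC°(Ω); in particular ξ + AC°(Ω) ⊆ Ω. -/
open Matrix Set Filter Topology Pointwise

noncomputable section

/-- The directions `u` such that `Ω` is stable under translation by all nonnegative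
multiples of `u`. -/
def recessionDirections {V : Type*} [AddCommGroup V] [Module ℝ V] (Ω : Set V) : Set V :=
  {u | ∀ x ∈ Ω, ∀ t : ℝ, 0 ≤ t → x + t • u ∈ Ω}

section RecessionCone

variable {V : Type*} [NormedAddCommGroup V] [NormedSpace ℝ V] {Ω : Set V}

theorem zero_mem_recessionDirections : (0 : V) ∈ recessionDirections Ω := by
  intro x hx t _
  simpa using hx

theorem smul_mem_recessionDirections {u : V} (hu : u ∈ recessionDirections Ω) {s : ℝ}
    (hs : 0 ≤ s) : s • u ∈ recessionDirections Ω := by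
  intro x hx t ht
  rw [smul_smul]
  exact hu x hx _ (mul_nonneg ht hs)

theorem add_mem_recessionDirections {u w : V} (hu : u ∈ recessionDirections Ω)
    (hw : w ∈ recessionDirections Ω) : u + w ∈ recessionDirections Ω := by
  intro x hx t ht
  rw [smul_add, ← add_assoc]
  exact hw _ (hu x hx t ht) t ht

theorem convex_recessionDirections : Convex ℝ (recessionDirections Ω) :=
  fun _ hu _ hw _ _ ha hb _ => add_mem_recessionDirections
    (smul_mem_recessionDirections hu ha) (smul_mem_recessionDirections hw hb)

theorem add_mem_closure_of_mem_recessionDirections {u x : V} (hu : u ∈ recessionDirections Ω)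
    (hx : x ∈ closure Ω) : x + u ∈ closure Ω :=
  map_mem_closure (f := fun y => y + u) (by fun_prop) hx
    (fun y hy => by simpa using hu y hy 1 zero_le_one)

theorem combo_mem_of_mem_closure (ho : IsOpen Ω) (hc : Convex ℝ Ω) {x y : V} (hx : x ∈ Ω)
    (hy : y ∈ closure Ω) {a b : ℝ} (ha : 0 < a) (hb : 0 ≤ b) (hab : a + b = 1) :
    a • x + b • y ∈ Ω := by
  have h := hc.combo_interior_closure_mem_interior (ho.interior_eq.symm ▸ hx) hy ha hb hab
  rwa [ho.interior_eq] at h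

/-- A limit of rescalings `t k • z k` of points of `closure Ω`, with `t k → 0`, is a recession
direction. -/
theorem mem_recessionDirections_of_tendsto (ho : IsOpen Ω) (hc : Convex ℝ Ω) {t : ℕ → ℝ}
    {z : ℕ → V} {d : V} (ht0 : ∀ k, 0 ≤ t k) (ht : Tendsto t atTop (𝓝 0))
    (hz : ∀ k, z k ∈ closure Ω) (hd : Tendsto (fun k => t k • z k) atTop (𝓝 d)) :
    d ∈ recessionDirections Ω := by
  have key : ∀ y ∈ Ω, ∀ T : ℝ, 0 ≤ T → y + T • d ∈ closure Ω := by
    intro y hy T hT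
    have hlim : Tendsto (fun k => (1 - T * t k) • y + T • (t k • z k)) atTop
        (𝓝 ((1 - T * 0) • y + T • d)) :=
      ((tendsto_const_nhds.sub (ht.const_mul T)).smul_const y).add (hd.const_smul T)
    have hpos : ∀ᶠ k in atTop, 0 < 1 - T * t k := by
      have : Tendsto (fun k => 1 - T * t k) atTop (𝓝 (1 - T * 0)) :=
        tendsto_const_nhds.sub (ht.const_mul T)
      exact this.eventually (lt_mem_nhds (by simp))
    have hmem : (1 - T * 0) • y + T • d ∈ closure Ω := by
      refine isClosed_closure.mem_of_tendsto hlim ?_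
      filter_upwards [hpos] with k hk
      rw [smul_smul]
      exact hc.closure (subset_closure hy) (hz k) hk.le (mul_nonneg hT (ht0 k)) (by ring)
    simpa using hmem
  intro y hy T hT
  have h := combo_mem_of_mem_closure ho hc hy (key y hy (2 * T) (by positivity))
    (a := 1 / 2) (b := 1 / 2) (by norm_num) (by norm_num) (by norm_num)
  convert h using 1
  module

theorem isClosed_recessionDirections (ho : IsOpen Ω) (hc : Convex ℝ Ω) (hne : Ω.Nonempty) :
    IsClosed (recessionDirections Ω) := by
  obtain ⟨x, hx⟩ := hne
  refine isClosed_of_closure_subset fun u hu => ?_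
  obtain ⟨v, hv, hlim⟩ := mem_closure_iff_seq_limit.1 hu
  have ht : Tendsto (fun k : ℕ => 1 / ((k : ℝ) + 1)) atTop (𝓝 0) :=
    tendsto_one_div_add_atTop_nhds_zero_nat
  refine mem_recessionDirections_of_tendsto ho hc (t := fun k : ℕ => 1 / ((k : ℝ) + 1))
    (z := fun k : ℕ => x + ((k : ℝ) + 1) • v k) (fun k => by positivity) ht
    (fun k => subset_closure (hv k x hx _ (by positivity))) ?_
  have h2 : Tendsto (fun k : ℕ => (1 / ((k : ℝ) + 1)) • x + v k) atTop (𝓝 ((0 : ℝ) • x + u)) :=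
    (ht.smul_const x).add hlim
  rw [zero_smul, zero_add] at h2
  refine h2.congr fun k => ?_
  have : (k : ℝ) + 1 ≠ 0 := by positivity
  rw [smul_add, smul_smul, one_div, inv_mul_cancel₀ this, one_smul]

/-- A nonempty convex domain without complete lines has a pointed recession cone. -/
theorem eq_zero_of_neg_mem_recessionDirections (hne : Ω.Nonempty)
    (hline : ¬ ∃ x ∈ Ω, ∃ v : V, v ≠ 0 ∧ ∀ t : ℝ, x + t • v ∈ Ω) {u : V}
    (hu : u ∈ recessionDirections Ω) (hu' : -u ∈ recessionDirections Ω) : u = 0 := by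
  by_contra h0
  obtain ⟨x, hx⟩ := hne
  refine hline ⟨x, hx, u, h0, fun t => ?_⟩
  rcases le_total 0 t with ht | ht
  · exact hu x hx t ht
  · simpa using hu' x hx (-t) (by linarith)

/-- An unbounded sequence has, after rescaling and passing to a subsequence, a unit limit
direction. -/
theorem exists_unit_direction_of_unbounded [FiniteDimensional ℝ V] {z : ℕ → V}
    (hz : ∀ k : ℕ, (k : ℝ) < ‖z k‖) :
    ∃ (d : V) (φ : ℕ → ℕ), ‖d‖ = 1 ∧ StrictMono φ ∧
      Tendsto (fun k => ‖z (φ k)‖⁻¹) atTop (𝓝 0) ∧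
      Tendsto (fun k => ‖z (φ k)‖⁻¹ • z (φ k)) atTop (𝓝 d) := by
  have := FiniteDimensional.proper_real V
  have hpos : ∀ k, 0 < ‖z k‖ := fun k => (Nat.cast_nonneg k).trans_lt (hz k)
  obtain ⟨d, hd, φ, hφ, hlim⟩ := (isCompact_sphere (0 : V) 1).tendsto_subseq
    (x := fun k => ‖z k‖⁻¹ • z k) (fun k => by
      rw [mem_sphere_zero_iff_norm, norm_smul, norm_inv, norm_norm,
        inv_mul_cancel₀ (hpos k).ne'])
  refine ⟨d, φ, mem_sphere_zero_iff_norm.1 hd, hφ, ?_, hlim⟩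
  have hinf : Tendsto (fun k => ‖z k‖) atTop atTop :=
    tendsto_atTop_mono (fun k => (hz k).le) tendsto_natCast_atTop_atTop
  exact (tendsto_inv_atTop_zero.comp hinf).comp hφ.tendsto_atTop

/-- Chords of `closure Ω` with midpoint in a bounded set are uniformly bounded. -/
theorem exists_chord_bound [FiniteDimensional ℝ V] (ho : IsOpen Ω) (hc : Convex ℝ Ω)
    (hpt : ∀ u ∈ recessionDirections Ω, -u ∈ recessionDirections Ω → u = 0)
    {K : Set V} (hK : Bornology.IsBounded K) :
    ∃ M : ℝ, ∀ y ∈ K, ∀ w, y + w ∈ closure Ω → y - w ∈ closure Ω → ‖w‖ ≤ M := by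
  by_contra! hcon
  choose y hy w hw1 hw2 hw using fun k : ℕ => hcon (k : ℝ)
  obtain ⟨d, φ, hd, hφ, ht, hlim⟩ := exists_unit_direction_of_unbounded hw
  obtain ⟨R, hR⟩ := hK.exists_norm_le
  have hy0 : Tendsto (fun k => ‖w (φ k)‖⁻¹ • y (φ k)) atTop (𝓝 0) :=
    ht.zero_smul_isBoundedUnder_le (isBoundedUnder_of ⟨R, fun k => hR _ (hy _)⟩)
  have h1 : d ∈ recessionDirections Ω := by
    refine mem_recessionDirections_of_tendsto ho hc (fun k => by positivity) ht
      (fun k => hw1 (φ k)) ?_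
    simpa [smul_add] using hy0.add hlim
  have h2 : -d ∈ recessionDirections Ω := by
    refine mem_recessionDirections_of_tendsto ho hc (fun k => by positivity) ht
      (fun k => hw2 (φ k)) ?_
    simpa [smul_sub] using hy0.sub hlim
  have := hpt d h1 h2
  simp [this] at hd

theorem nonneg_of_bddBelow_on_ray {a b m : ℝ} (h : ∀ t : ℝ, 0 ≤ t → m ≤ a + t * b) : 0 ≤ b := by
  by_contra! hb
  have hm := h 0 le_rfl
  have h1 := h ((a - m + 1) / (-b)) (div_nonneg (by linarith) (by linarith))
  have h2 : (a - m + 1) / (-b) * b = -(a - m + 1) := by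
    rw [div_neg, neg_mul, div_mul_cancel₀ _ hb.ne]
  linarith

/-- A pointed closed recession cone admits a coercive linear functional. -/
theorem exists_coercive_functional [FiniteDimensional ℝ V]
    (hcl : IsClosed (recessionDirections Ω))
    (hpt : ∀ u ∈ recessionDirections Ω, -u ∈ recessionDirections Ω → u = 0) :
    ∃ (f : V →L[ℝ] ℝ) (a : ℝ), 0 < a ∧ ∀ c ∈ recessionDirections Ω, a * ‖c‖ ≤ f c := by
  have := FiniteDimensional.proper_real V
  have hsep : ∀ c ∈ recessionDirections Ω, c ≠ 0 →
      ∃ f : V →L[ℝ] ℝ, (∀ u ∈ recessionDirections Ω, 0 ≤ f u) ∧ 0 < f c := by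
    intro c hc hc0
    obtain ⟨f, m, h1, h2⟩ := geometric_hahn_banach_point_closed convex_recessionDirections hcl
      (fun h => hc0 (hpt c hc h))
    have h0 := h2 0 zero_mem_recessionDirections
    rw [map_zero] at h0
    rw [map_neg] at h1
    refine ⟨f, fun u hu => nonneg_of_bddBelow_on_ray (a := 0) (m := m) fun t ht => ?_,
      by linarith⟩
    simpa using (h2 _ (smul_mem_recessionDirections hu ht)).le
  have hcomp : IsCompact (recessionDirections Ω ∩ Metric.sphere 0 1) :=
    (isCompact_sphere (0 : V) 1).inter_left hcl
  obtain ⟨f, -, hf⟩ : ∃ f : V →L[ℝ] ℝ, (∀ c ∈ recessionDirections Ω, 0 ≤ f c) ∧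
      ∀ c ∈ recessionDirections Ω ∩ Metric.sphere 0 1, c ∈ recessionDirections Ω → 0 < f c := by
    refine hcomp.induction_on (p := fun s => ∃ f : V →L[ℝ] ℝ,
      (∀ c ∈ recessionDirections Ω, 0 ≤ f c) ∧ ∀ c ∈ s, c ∈ recessionDirections Ω → 0 < f c)
      ⟨0, by simp, by simp⟩ ?_ ?_ ?_
    · rintro s t hst ⟨f, h1, h2⟩
      exact ⟨f, h1, fun c hc => h2 c (hst hc)⟩
    · rintro s t ⟨f, hf1, hf2⟩ ⟨g, hg1, hg2⟩
      refine ⟨f + g, fun c hc => add_nonneg (hf1 c hc) (hg1 c hc), ?_⟩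
      rintro c (hc | hc) hcC
      · exact add_pos_of_pos_of_nonneg (hf2 c hc hcC) (hg1 c hcC)
      · exact add_pos_of_nonneg_of_pos (hf1 c hcC) (hg2 c hc hcC)
    · rintro c ⟨hc, hc1⟩
      obtain ⟨f, hf, hfc⟩ := hsep c hc (by rintro rfl; simp at hc1)
      refine ⟨{x | 0 < f x}, ?_, f, hf, fun x hx _ => hx⟩
      exact mem_nhdsWithin_of_mem_nhds (f.continuous.continuousAt.eventually (lt_mem_nhds hfc))
  obtain ⟨a, ha, hfa⟩ : ∃ a : ℝ, 0 < a ∧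
      ∀ c ∈ recessionDirections Ω ∩ Metric.sphere 0 1, a ≤ f c := by
    rcases (recessionDirections Ω ∩ Metric.sphere (0 : V) 1).eq_empty_or_nonempty with h | h
    · exact ⟨1, one_pos, by simp [h]⟩
    · obtain ⟨c, hc, hmin⟩ := hcomp.exists_isMinOn h f.continuous.continuousOn
      exact ⟨f c, hf c hc hc.1, hmin⟩
  refine ⟨f, a, ha, fun c hc => ?_⟩
  rcases eq_or_ne c 0 with rfl | hc0
  · simp
  have hn : 0 < ‖c‖ := norm_pos_iff.2 hc0
  have h := hfa (‖c‖⁻¹ • c) ⟨smul_mem_recessionDirections hc (by positivity), by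
    rw [mem_sphere_zero_iff_norm, norm_smul, norm_inv, norm_norm, inv_mul_cancel₀ hn.ne']⟩
  rw [map_smul, smul_eq_mul, inv_mul_eq_div, le_div_iff₀ hn] at h
  exact h

/-- The intrinsic interior of the recession cone, described by balls in its linear span. -/
theorem mem_intrinsicInterior_recessionDirections_iff {u : V} :
    u ∈ intrinsicInterior ℝ (recessionDirections Ω) ↔
      ∃ ε : ℝ, 0 < ε ∧ ∀ e ∈ Submodule.span ℝ (recessionDirections Ω), ‖e‖ < ε →
        u + e ∈ recessionDirections Ω := by
  have hspan : ∀ x, x ∈ affineSpan ℝ (recessionDirections Ω) ↔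
      x ∈ Submodule.span ℝ (recessionDirections Ω) := by
    intro x
    have h := affineSpan_insert_zero (k := ℝ) (recessionDirections Ω)
    rw [insert_eq_of_mem zero_mem_recessionDirections] at h
    exact Set.ext_iff.1 h x
  rw [mem_intrinsicInterior]
  constructor
  · rintro ⟨y, hy, rfl⟩
    obtain ⟨ε, hε, hball⟩ := Metric.mem_nhds_iff.1 (mem_interior_iff_mem_nhds.1 hy)
    refine ⟨ε, hε, fun e he hn => ?_⟩
    have hmem : (y : V) + e ∈ affineSpan ℝ (recessionDirections Ω) :=
      (hspan _).2 (add_mem ((hspan _).1 y.2) he)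
    have : (⟨(y : V) + e, hmem⟩ : affineSpan ℝ (recessionDirections Ω)) ∈ Metric.ball y ε := by
      rw [Metric.mem_ball, Subtype.dist_eq, dist_eq_norm]
      simpa using hn
    exact hball this
  · rintro ⟨ε, hε, hball⟩
    have hu : u ∈ recessionDirections Ω := by simpa using hball 0 (zero_mem _) (by simpa using hε)
    refine ⟨⟨u, (hspan u).2 (Submodule.subset_span hu)⟩, ?_, rfl⟩
    refine mem_interior_iff_mem_nhds.2 (Metric.mem_nhds_iff.2 ⟨ε, hε, fun y hy => ?_⟩)
    rw [Metric.mem_ball, Subtype.dist_eq, dist_eq_norm] at hy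
    have := hball ((y : V) - u) (sub_mem ((hspan _).1 y.2) (Submodule.subset_span hu)) hy
    simpa using this

/-- A linear map preserving the recession cone is controlled on the span of the cone by its value
at an intrinsic interior point. -/
theorem exists_norm_bound_of_mapsTo {f : V →L[ℝ] ℝ} {a : ℝ} (ha : 0 < a)
    (hf : ∀ c ∈ recessionDirections Ω, a * ‖c‖ ≤ f c) {v : V}
    (hv : v ∈ intrinsicInterior ℝ (recessionDirections Ω)) (M : ℝ) :
    ∃ M' : ℝ, ∀ B : V →ₗ[ℝ] V, (∀ c ∈ recessionDirections Ω, B c ∈ recessionDirections Ω) →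
      ‖B v‖ ≤ M → ∀ e ∈ Submodule.span ℝ (recessionDirections Ω), ‖B e‖ ≤ M' * ‖e‖ := by
  obtain ⟨ε, hε, hball⟩ := mem_intrinsicInterior_recessionDirections_iff.1 hv
  refine ⟨(2 * ‖f‖ * M / a + M) * (2 / ε), fun B hB hBv e he => ?_⟩
  rcases eq_or_ne e 0 with rfl | he0
  · simp
  have hn : 0 < ‖e‖ := norm_pos_iff.2 he0
  set r : ℝ := ε / 2 / ‖e‖ with hr
  have hrpos : 0 < r := by positivity
  have hre : ‖r • e‖ < ε := by
    rw [norm_smul, Real.norm_of_nonneg hrpos.le, hr, div_mul_cancel₀ _ hn.ne']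
    linarith
  have h1 := hB _ (hball (r • e) (Submodule.smul_mem _ _ he) hre)
  have h2 := hB _ (hball (-(r • e)) (neg_mem (Submodule.smul_mem _ _ he)) (by rwa [norm_neg]))
  have h3 : f (B (v + r • e)) ≤ 2 * ‖f‖ * M := by
    have hpos : 0 ≤ f (B (v + -(r • e))) := (mul_nonneg ha.le (norm_nonneg _)).trans (hf _ h2)
    have hsum : f (B (v + r • e)) + f (B (v + -(r • e))) = 2 * f (B v) := by
      simp only [map_add, map_neg]
      ring
    have hle : f (B v) ≤ ‖f‖ * M :=
      (le_abs_self _).trans ((f.le_opNorm _).trans (by gcongr))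
    linarith
  have h4 : ‖B (v + r • e)‖ ≤ 2 * ‖f‖ * M / a := by
    rw [le_div_iff₀ ha, mul_comm]
    exact (hf _ h1).trans h3
  have h5 : ‖B (r • e)‖ ≤ 2 * ‖f‖ * M / a + M := by
    have : B (r • e) = B (v + r • e) - B v := by simp
    rw [this]
    exact (norm_sub_le _ _).trans (add_le_add h4 hBv)
  rw [map_smul, norm_smul, Real.norm_of_nonneg hrpos.le, hr] at h5
  calc ‖B e‖ = (ε / 2 / ‖e‖ * ‖B e‖) * (2 / ε) * ‖e‖ := by field_simp
    _ ≤ _ := by gcongr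

end RecessionCone

section AffineSymmetry

variable {V : Type*} [NormedAddCommGroup V] [NormedSpace ℝ V] {Ω : Set V}

theorem map_mem_closure_of_symmetry {A : V ≃L[ℝ] V} {b : V} (h : ∀ z, A z + b ∈ Ω ↔ z ∈ Ω)
    {z : V} (hz : z ∈ closure Ω) : A z + b ∈ closure Ω :=
  map_mem_closure (f := fun y => A y + b) (by fun_prop) hz (fun y hy => (h y).2 hy)

theorem map_mem_recessionDirections {A : V ≃L[ℝ] V} {b : V} (h : ∀ z, A z + b ∈ Ω ↔ z ∈ Ω)
    {u : V} (hu : u ∈ recessionDirections Ω) : A u ∈ recessionDirections Ω := by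
  intro x hx t ht
  have hx' : A.symm (x - b) ∈ Ω := (h _).1 (by simpa using hx)
  have := (h _).2 (hu _ hx' t ht)
  simpa [map_add, add_right_comm] using this

theorem symm_map_mem_recessionDirections {A : V ≃L[ℝ] V} {b : V}
    (h : ∀ z, A z + b ∈ Ω ↔ z ∈ Ω) {u : V} (hu : u ∈ recessionDirections Ω) :
    A.symm u ∈ recessionDirections Ω := by
  intro x hx t ht
  have := hu _ ((h x).2 hx) t ht
  refine (h _).1 ?_
  simpa [map_add, add_right_comm] using this

/-- In a quasi-homogeneous domain, translating a point of the closure by an intrinsic interior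
point of the recession cone leads into the domain. -/
theorem add_mem_of_mem_intrinsicInterior [FiniteDimensional ℝ V] (ho : IsOpen Ω)
    (hc : Convex ℝ Ω) (hne : Ω.Nonempty)
    (hpt : ∀ u ∈ recessionDirections Ω, -u ∈ recessionDirections Ω → u = 0)
    {K : Set V} (hK : IsCompact K) (hKΩ : K ⊆ Ω)
    (hqh : ∀ x ∈ Ω, ∃ (A : V ≃L[ℝ] V) (b : V), (∀ z, A z + b ∈ Ω ↔ z ∈ Ω) ∧ A x + b ∈ K)
    {ξ v : V} (hξ : ξ ∈ closure Ω) (hv : v ∈ intrinsicInterior ℝ (recessionDirections Ω)) :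
    ξ + v ∈ Ω := by
  have := FiniteDimensional.proper_real V
  by_contra hnot
  obtain ⟨F, hF⟩ := geometric_hahn_banach_open_point hc ho hnot
  obtain ⟨x, hx⟩ := hne
  have hFC : ∀ u ∈ recessionDirections Ω, F u ≤ 0 := by
    intro u hu
    have : 0 ≤ -F u := nonneg_of_bddBelow_on_ray (a := -F x) (m := -F (ξ + v)) fun t ht => by
      have := hF _ (hu x hx t ht)
      rw [map_add F x, map_smul, smul_eq_mul] at this
      linarith
    linarith
  have hFv : 0 ≤ F v := by
    have : F ξ ≤ F (ξ + v) := by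
      have hcl : IsClosed {z | F z ≤ F (ξ + v)} := isClosed_le F.continuous continuous_const
      exact closure_minimal (fun z hz => (hF z hz).le) hcl hξ
    rw [map_add] at this
    linarith
  have hF0 : ∀ u ∈ recessionDirections Ω, F u = 0 := by
    intro u hu
    obtain ⟨ε, hε, hball⟩ := mem_intrinsicInterior_recessionDirections_iff.1 hv
    obtain ⟨r, hr, hru⟩ : ∃ r : ℝ, 0 < r ∧ ‖r • u‖ < ε := by
      refine ⟨ε / (‖u‖ + 1), by positivity, ?_⟩
      rw [norm_smul, Real.norm_of_nonneg (by positivity), div_mul_eq_mul_div,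
        div_lt_iff₀ (by positivity)]
      nlinarith [norm_nonneg u]
    have h1 := hFC _ (hball (-(r • u)) (neg_mem (Submodule.smul_mem _ _
      (Submodule.subset_span hu))) (by rwa [norm_neg]))
    rw [map_add, map_neg, map_smul, smul_eq_mul] at h1
    have h2 := hFC u hu
    nlinarith
  have hFξ : ∀ a ∈ Ω, F a < F ξ := by
    have h0 := hF0 v (intrinsicInterior_subset hv)
    intro a ha
    simpa [h0] using hF a ha
  set s : ℕ → ℝ := fun k => 1 / ((k : ℝ) + 1) / 2 with hs
  have hs0 : ∀ k, 0 < s k := fun k => by positivity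
  have hs1 : ∀ k, s k ≤ 1 / 2 := fun k => by
    have : 1 / ((k : ℝ) + 1) ≤ 1 := by
      rw [div_le_one (by positivity)]
      linarith [(Nat.cast_nonneg k : (0 : ℝ) ≤ k)]
    simp only [hs]
    linarith
  have hslim : Tendsto s atTop (𝓝 0) := by
    simpa [hs] using (tendsto_one_div_add_atTop_nhds_zero_nat (𝕜 := ℝ)).div_const 2
  have hxk : ∀ k, ξ + s k • (x - ξ) ∈ Ω := by
    intro k
    have := combo_mem_of_mem_closure ho hc hx hξ (hs0 k) (b := 1 - s k)
      (by linarith [hs1 k]) (by ring)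
    convert this using 1
    module
  choose A b hA hAK using fun k => hqh _ (hxk k)
  set y : ℕ → V := fun k => A k (ξ + s k • (x - ξ)) + b k with hy
  set w : ℕ → V := fun k => s k • A k (x - ξ) with hw
  have hyw : ∀ k, y k - w k = A k ξ + b k := fun k => by
    simp only [hy, hw, map_add, map_smul]
    abel
  have hyx : ∀ k, s k • (A k x + b k) = s k • y k + (1 - s k) • w k := fun k => by
    simp only [hy, hw, map_add, map_smul, map_sub]
    module
  have hminus : ∀ k, y k - w k ∈ closure Ω := fun k => by
    rw [hyw]
    exact map_mem_closure_of_symmetry (hA k) hξ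
  have hplus : ∀ k, y k + w k ∈ closure Ω := fun k => by
    have h2 : ξ + (2 * s k) • (x - ξ) ∈ closure Ω := by
      have := hc.closure (subset_closure hx) hξ (a := 2 * s k) (b := 1 - 2 * s k)
        (by linarith [hs0 k]) (by linarith [hs1 k]) (by ring)
      convert this using 1
      module
    convert map_mem_closure_of_symmetry (hA k) h2 using 1
    simp only [hy, hw, map_add, map_smul]
    module
  obtain ⟨M, hM⟩ := exists_chord_bound ho hc hpt hK.isBounded
  obtain ⟨w', -, φ, hφ, hlim⟩ := tendsto_subseq_of_bounded
    (Metric.isBounded_closedBall (x := (0 : V)) (r := M)) (x := w)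
    (fun k => mem_closedBall_zero_iff.2 (hM _ (hAK k) _ (hplus k) (hminus k)))
  have hsφ : Tendsto (fun k => s (φ k)) atTop (𝓝 0) := hslim.comp hφ.tendsto_atTop
  obtain ⟨R, hR⟩ := hK.isBounded.exists_norm_le
  have hw' : w' ∈ recessionDirections Ω := by
    refine mem_recessionDirections_of_tendsto ho hc (fun k => (hs0 (φ k)).le) hsφ
      (z := fun k => A (φ k) x + b (φ k)) (fun k => subset_closure ((hA _ _).2 hx)) ?_
    simp only [hyx]
    have h1 : Tendsto (fun k => s (φ k) • y (φ k)) atTop (𝓝 0) :=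
      hsφ.zero_smul_isBoundedUnder_le (isBoundedUnder_of ⟨R, fun k => hR _ (hAK _)⟩)
    simpa using h1.add ((tendsto_const_nhds (x := (1 : ℝ)).sub hsφ).smul hlim)
  obtain ⟨δ, hδ, hδK⟩ := hK.exists_cthickening_subset_open ho hKΩ
  have hclose : ∀ᶠ k in atTop, ‖w (φ k) - w'‖ < δ / 2 := by
    have := (tendsto_iff_norm_sub_tendsto_zero.1 hlim).eventually (gt_mem_nhds (half_pos hδ))
    exact this
  obtain ⟨k, hk⟩ := hclose.exists
  set j := φ k
  have hmem : y j + -((2 : ℝ) • (w j - w')) ∈ Ω := by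
    refine hδK (Metric.mem_cthickening_of_dist_le _ (y j) _ _ (hAK j) ?_)
    rw [dist_eq_norm, add_sub_cancel_left, norm_neg, norm_smul, Real.norm_of_nonneg zero_le_two]
    linarith
  have hpre : ξ + s j • (x - ξ) + -((2 : ℝ) • (s j • (x - ξ) - (A j).symm w')) ∈ Ω := by
    refine (hA j _).1 ?_
    convert hmem using 1
    simp only [hy, hw, map_add, map_smul, map_neg, map_sub, ContinuousLinearEquiv.apply_symm_apply]
    abel
  have h1 := hFξ _ hpre
  have h2 := hF0 _ (symm_map_mem_recessionDirections (hA j) hw')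
  have h3 := hFξ x hx
  simp only [map_add, map_neg, map_smul, map_sub, h2, smul_eq_mul] at h1
  nlinarith [hs0 j]

/-- In a quasi-homogeneous domain, each slice of the closure parallel to the span of the recession
cone is contained in a translate of the recession cone based at one of its points. -/
theorem exists_slice_subset_translate [FiniteDimensional ℝ V] (ho : IsOpen Ω)
    (hc : Convex ℝ Ω) (hne : Ω.Nonempty)
    (hpt : ∀ u ∈ recessionDirections Ω, -u ∈ recessionDirections Ω → u = 0)
    {K : Set V} (hK : IsCompact K) (hKΩ : K ⊆ Ω)
    (hqh : ∀ x ∈ Ω, ∃ (A : V ≃L[ℝ] V) (b : V), (∀ z, A z + b ∈ Ω ↔ z ∈ Ω) ∧ A x + b ∈ K)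
    {ξ : V} (hξ : ξ ∈ closure Ω) :
    ∃ p ∈ closure Ω, p - ξ ∈ Submodule.span ℝ (recessionDirections Ω) ∧
      ∀ z ∈ closure Ω, z - ξ ∈ Submodule.span ℝ (recessionDirections Ω) →
        z - p ∈ recessionDirections Ω := by
  have := FiniteDimensional.proper_real V
  have hcl : IsClosed (recessionDirections Ω) := isClosed_recessionDirections ho hc hne
  set E := Submodule.span ℝ (recessionDirections Ω) with hE
  have hEcl : IsClosed (E : Set V) := E.closed_of_finiteDimensional
  obtain ⟨f, a, ha, hf⟩ := exists_coercive_functional hcl hpt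
  obtain ⟨p, hp, hpE, hmin⟩ : ∃ p ∈ closure Ω, p - ξ ∈ E ∧
      ∀ z ∈ closure Ω, z - ξ ∈ E → f p ≤ f z := by
    set Z : Set V := (closure Ω ∩ {z | z - ξ ∈ E}) ∩ {z | f z ≤ f ξ} with hZ
    have hZcl : IsClosed Z := (isClosed_closure.inter (hEcl.preimage (by fun_prop))).inter
      (isClosed_le f.continuous continuous_const)
    have hZbd : ∃ R, ∀ z ∈ Z, ‖z‖ ≤ R := by
      by_contra! hcon
      choose z hz hzn using fun k : ℕ => hcon (k : ℝ)
      obtain ⟨d, φ, hd, -, ht, hlim⟩ := exists_unit_direction_of_unbounded hzn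
      have hdC : d ∈ recessionDirections Ω :=
        mem_recessionDirections_of_tendsto ho hc (fun k => by positivity) ht
          (fun k => (hz (φ k)).1.1) hlim
      have hfd : f d ≤ 0 := by
        refine le_of_tendsto_of_tendsto ((f.continuous.tendsto d).comp hlim)
          (by simpa using ht.mul_const (f ξ)) (Eventually.of_forall fun k => ?_)
        simp only [Function.comp, map_smul, smul_eq_mul]
        exact mul_le_mul_of_nonneg_left (hz (φ k)).2 (by positivity)
      have := hf d hdC
      rw [hd] at this
      linarith
    obtain ⟨R, hR⟩ := hZbd
    have hZcomp : IsCompact Z := Metric.isCompact_of_isClosed_isBounded hZcl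
      (isBounded_iff_forall_norm_le.2 ⟨R, hR⟩)
    obtain ⟨p, hpZ, hpmin⟩ := hZcomp.exists_isMinOn ⟨ξ, ⟨hξ, by simp⟩, le_refl (f ξ)⟩
      f.continuous.continuousOn
    refine ⟨p, hpZ.1.1, hpZ.1.2, fun z hz hzE => ?_⟩
    rcases le_total (f z) (f ξ) with h | h
    · exact hpmin ⟨⟨hz, hzE⟩, h⟩
    · exact hpZ.2.trans h
  refine ⟨p, hp, hpE, fun z hz hzE => ?_⟩
  have heE : z - p ∈ E := by
    have := sub_mem hzE hpE
    simpa using this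
  obtain ⟨v, hv⟩ := Set.Nonempty.intrinsicInterior (convex_recessionDirections (Ω := Ω))
    ⟨0, zero_mem_recessionDirections⟩
  have hvC := intrinsicInterior_subset hv
  have hpv : p + v ∈ Ω := add_mem_of_mem_intrinsicInterior ho hc hne hpt hK hKΩ hqh hp hv
  set s : ℕ → ℝ := fun k => 1 / ((k : ℝ) + 1) with hs
  have hs0 : ∀ k, 0 < s k := fun k => by positivity
  have hs1 : ∀ k, s k ≤ 1 := fun k => by
    rw [div_le_one (by positivity)]
    linarith [(Nat.cast_nonneg k : (0 : ℝ) ≤ k)]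
  have hslim : Tendsto s atTop (𝓝 0) := tendsto_one_div_add_atTop_nhds_zero_nat
  have hxk : ∀ k, p + s k • v ∈ Ω := by
    intro k
    have := combo_mem_of_mem_closure ho hc hpv hp (hs0 k) (b := 1 - s k)
      (by linarith [hs1 k]) (by ring)
    convert this using 1
    module
  choose A b hA hAK using fun k => hqh _ (hxk k)
  set y : ℕ → V := fun k => A k (p + s k • v) + b k with hy
  set B : ℕ → V →ₗ[ℝ] V := fun k => s k • ((A k : V →L[ℝ] V) : V →ₗ[ℝ] V) with hB
  set B' : ℕ → V →ₗ[ℝ] V :=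
    fun k => (s k)⁻¹ • (((A k).symm : V →L[ℝ] V) : V →ₗ[ℝ] V) with hB'
  have hBapp : ∀ k u, B k u = s k • A k u := fun k u => rfl
  have hB'app : ∀ k u, B' k u = (s k)⁻¹ • (A k).symm u := fun k u => rfl
  have hBC : ∀ k, ∀ c ∈ recessionDirections Ω, B k c ∈ recessionDirections Ω := fun k c hcC =>
    smul_mem_recessionDirections (map_mem_recessionDirections (hA k) hcC) (hs0 k).le
  have hB'C : ∀ k, ∀ c ∈ recessionDirections Ω, B' k c ∈ recessionDirections Ω := fun k c hcC =>
    smul_mem_recessionDirections (symm_map_mem_recessionDirections (hA k) hcC)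
      (inv_nonneg.2 (hs0 k).le)
  have hB'B : ∀ k u, B' k (B k u) = u := fun k u => by
    rw [hBapp, hB'app, map_smul, ContinuousLinearEquiv.symm_apply_apply, smul_smul,
      inv_mul_cancel₀ (hs0 k).ne', one_smul]
  have hyB : ∀ k, y k - B k v = A k p + b k := fun k => by
    simp only [hy, hBapp, map_add, map_smul]
    abel
  obtain ⟨M, hM⟩ := exists_chord_bound ho hc hpt hK.isBounded
  have hBv : ∀ k, ‖B k v‖ ≤ M := fun k => by
    refine hM _ (hAK k) _ ?_ ?_
    · exact add_mem_closure_of_mem_recessionDirections (hBC k v hvC)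
        (subset_closure (hKΩ (hAK k)))
    · change y k - B k v ∈ closure Ω
      rw [hyB]
      exact map_mem_closure_of_symmetry (hA k) hp
  obtain ⟨δ, hδ, hδK⟩ := hK.exists_cthickening_subset_open ho hKΩ
  obtain ⟨r, hr, hrv⟩ : ∃ r : ℝ, 0 < r ∧ ‖r • v‖ ≤ δ := by
    refine ⟨δ / (‖v‖ + 1), by positivity, ?_⟩
    rw [norm_smul, Real.norm_of_nonneg (by positivity), div_mul_eq_mul_div,
      div_le_iff₀ (by positivity)]
    nlinarith [norm_nonneg v]
  have hB'v : ∀ k, ‖B' k v‖ ≤ f v / r / a := fun k => by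
    have hmem : y k - r • v ∈ Ω := by
      refine hδK (Metric.mem_cthickening_of_dist_le _ (y k) _ _ (hAK k) ?_)
      rwa [dist_eq_norm, sub_sub_cancel_left, norm_neg]
    have hpre : p + s k • (v - r • B' k v) ∈ Ω := by
      refine (hA k _).1 ?_
      convert hmem using 1
      simp only [hy, hB'app, map_add, map_smul, map_sub, smul_sub,
        ContinuousLinearEquiv.apply_symm_apply]
      rw [smul_smul r, mul_comm r, ← smul_smul, smul_smul (s k), mul_inv_cancel₀ (hs0 k).ne',
        one_smul]
      abel
    have hle := hmin _ (subset_closure hpre) (by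
      have h1 : s k • (v - r • B' k v) ∈ E := E.smul_mem _ (sub_mem (Submodule.subset_span hvC)
        (E.smul_mem _ (Submodule.subset_span (hB'C k v hvC))))
      have := add_mem hpE h1
      rwa [sub_add_eq_add_sub] at this)
    simp only [map_add, map_smul, map_sub, smul_eq_mul] at hle
    have h2 : 0 ≤ f v - r * f (B' k v) := by
      have : 0 ≤ s k * (f v - r * f (B' k v)) := by linarith
      exact nonneg_of_mul_nonneg_right this (hs0 k)
    rw [le_div_iff₀ ha, mul_comm, le_div_iff₀ hr]
    nlinarith [hf _ (hB'C k v hvC)]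
  obtain ⟨M₁, hM₁⟩ := exists_norm_bound_of_mapsTo ha hf hv M
  obtain ⟨M₂, hM₂⟩ := exists_norm_bound_of_mapsTo ha hf hv (f v / r / a)
  obtain ⟨w, -, φ, hφ, hlim⟩ := tendsto_subseq_of_bounded
    (Metric.isBounded_closedBall (x := (0 : V)) (r := M₁ * ‖z - p‖)) (x := fun k => B k (z - p))
    (fun k => mem_closedBall_zero_iff.2 (hM₁ _ (hBC k) (hBv k) _ heE))
  have hsφ : Tendsto (fun k => s (φ k)) atTop (𝓝 0) := hslim.comp hφ.tendsto_atTop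
  obtain ⟨R, hR⟩ := hK.isBounded.exists_norm_le
  have hw : w ∈ recessionDirections Ω := by
    refine mem_recessionDirections_of_tendsto ho hc (fun k => (hs0 (φ k)).le) hsφ
      (z := fun k => A (φ k) z + b (φ k)) (fun k => map_mem_closure_of_symmetry (hA _) hz) ?_
    have heq : ∀ k, s k • (A k z + b k) = s k • (y k - B k v) + B k (z - p) := fun k => by
      rw [hyB, hBapp, map_sub]
      module
    simp only [heq]
    have h1 : Tendsto (fun k => s (φ k) • (y (φ k) - B (φ k) v)) atTop (𝓝 0) :=
      hsφ.zero_smul_isBoundedUnder_le (isBoundedUnder_of ⟨R + M, fun k =>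
        (norm_sub_le _ _).trans (add_le_add (hR _ (hAK _)) (hBv _))⟩)
    simpa using h1.add hlim
  have hBE : ∀ k, B k (z - p) ∈ E := fun k => by
    have : E ≤ E.comap (B k) := Submodule.span_le.2 fun c hcC =>
      Submodule.subset_span (hBC k c hcC)
    exact this heE
  have hfinal : Tendsto (fun k => B' (φ k) w) atTop (𝓝 (z - p)) := by
    rw [tendsto_iff_norm_sub_tendsto_zero]
    refine squeeze_zero (fun _ => norm_nonneg _) (g := fun k => M₂ * ‖B (φ k) (z - p) - w‖)
      (fun k => ?_) ?_
    · have h1 := hM₂ _ (hB'C (φ k)) (hB'v (φ k)) _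
        (sub_mem (hBE (φ k)) (Submodule.subset_span hw))
      rwa [map_sub, hB'B, norm_sub_rev] at h1
    · simpa using (tendsto_iff_norm_sub_tendsto_zero.1 hlim).const_mul M₂
  exact hcl.mem_of_tendsto hfinal (Eventually.of_forall fun k => hB'C _ w hw)

end AffineSymmetry

/-- An affine-form matrix acts as an invertible linear map followed by a translation. -/
theorem exists_linearEquiv_of_isAffineForm {n : ℕ} {g : GL (Fin (n + 1)) ℝ}
    (hg : IsAffineForm n g) :
    ∃ (A : (Fin n → ℝ) ≃L[ℝ] (Fin n → ℝ)) (b : Fin n → ℝ), ∀ x, affAct n g x = A x + b := by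
  set L : (Fin n → ℝ) →ₗ[ℝ] (Fin n → ℝ) :=
    Matrix.mulVecLin (Matrix.of fun i j : Fin n => g.val i.castSucc j.castSucc) with hL
  have hinj : Function.Injective L := by
    rw [← LinearMap.ker_eq_bot, LinearMap.ker_eq_bot']
    intro x hx
    have hgi : Function.Injective g.val.mulVec := Matrix.mulVec_injective_of_isUnit g.isUnit
    have h0 : g.val.mulVec (Fin.snoc (α := fun _ => ℝ) x 0) = g.val.mulVec 0 := by
      rw [Matrix.mulVec_zero]
      funext i
      simp only [Matrix.mulVec, dotProduct, Fin.sum_univ_castSucc, Fin.snoc_castSucc,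
        Fin.snoc_last, mul_zero, add_zero, Pi.zero_apply]
      refine Fin.lastCases ?_ (fun i => ?_) i
      · simp [hg.1]
      · exact congrFun hx i
    have h1 := hgi h0
    funext i
    simpa using congrFun h1 i.castSucc
  refine ⟨(LinearEquiv.ofInjectiveEndo L hinj).toContinuousLinearEquiv,
    fun i => g.val i.castSucc (Fin.last n), fun x => ?_⟩
  rfl

/-- Every point of a quasi-homogeneous domain can be moved into a fixed compact subset by an
affine symmetry. -/
theorem IsQuasiHomogeneous.exists_symmetry {n : ℕ} {Ω : Set (Fin n → ℝ)}
    (h : IsQuasiHomogeneous n Ω) :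
    ∃ K : Set (Fin n → ℝ), IsCompact K ∧ K ⊆ Ω ∧ ∀ x ∈ Ω,
      ∃ (A : (Fin n → ℝ) ≃L[ℝ] (Fin n → ℝ)) (b : Fin n → ℝ),
        (∀ z, A z + b ∈ Ω ↔ z ∈ Ω) ∧ A x + b ∈ K := by
  obtain ⟨K, hK, hKΩ, hcov⟩ := h
  refine ⟨K, hK, hKΩ, fun x hx => ?_⟩
  rw [← hcov] at hx
  simp only [mem_iUnion] at hx
  obtain ⟨g, ⟨hg, hgΩ⟩, y, hy, rfl⟩ := hx
  obtain ⟨A, b, hAb⟩ := exists_linearEquiv_of_isAffineForm hg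
  refine ⟨A.symm, -A.symm b, fun z => ?_, ?_⟩
  · constructor
    · intro hz
      rw [← hgΩ]
      exact ⟨_, hz, by rw [hAb]; simp⟩
    · intro hz
      rw [← hgΩ] at hz
      obtain ⟨u, hu, rfl⟩ := hz
      rw [hAb]
      simpa using hu
  · rw [hAb]
    simpa using hy

/-- for an extreme point ξ of the closure of a quasi-homogeneous properly
convex domain, (ξ + AC(Ω)) ∩ Ω = ξ + AC°(Ω); in particular ξ + AC°(Ω) ⊆ Ω. -/
theorem translate_asympCone_inter_eq (n : ℕ) (Ω : Set (Fin n → ℝ))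
    (h1 : IsProperlyConvexDomain n Ω) (h2 : IsQuasiHomogeneous n Ω)
    (ξ : Fin n → ℝ) (hξ : ξ ∈ Set.extremePoints ℝ (closure Ω)) :
    ((fun u => ξ + u) '' asympCone n Ω) ∩ Ω
        = (fun u => ξ + u) '' intrinsicInterior ℝ (asympCone n Ω) ∧
      (fun u => ξ + u) '' intrinsicInterior ℝ (asympCone n Ω) ⊆ Ω := by
  obtain ⟨⟨hne, ho, hc⟩, hline⟩ := h1
  obtain ⟨K, hK, hKΩ, hqh⟩ := h2.exists_symmetry
  change ((fun u => ξ + u) '' recessionDirections Ω) ∩ Ω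
        = (fun u => ξ + u) '' intrinsicInterior ℝ (recessionDirections Ω) ∧
      (fun u => ξ + u) '' intrinsicInterior ℝ (recessionDirections Ω) ⊆ Ω
  have hpt : ∀ u ∈ recessionDirections Ω, -u ∈ recessionDirections Ω → u = 0 :=
    fun u hu hu' => eq_zero_of_neg_mem_recessionDirections hne hline hu hu'
  have hsub : (fun u => ξ + u) '' intrinsicInterior ℝ (recessionDirections Ω) ⊆ Ω := by
    rintro _ ⟨v, hv, rfl⟩
    exact add_mem_of_mem_intrinsicInterior ho hc hne hpt hK hKΩ hqh hξ.1 hv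
  refine ⟨Subset.antisymm ?_ (subset_inter (image_mono intrinsicInterior_subset) hsub), hsub⟩
  rintro _ ⟨⟨u, hu, rfl⟩, huΩ⟩
  refine ⟨u, ?_, rfl⟩
  obtain ⟨p, hp, -, hslice⟩ := exists_slice_subset_translate ho hc hne hpt hK hKΩ hqh hξ.1
  have hpξ : p = ξ := by
    have hd : ξ - p ∈ recessionDirections Ω := hslice ξ hξ.1 (by simp)
    have hq : ξ + (ξ - p) ∈ closure Ω := add_mem_closure_of_mem_recessionDirections hd hξ.1
    refine ((mem_extremePoints.1 hξ).2 p hp _ hq ⟨1 / 2, 1 / 2, by norm_num, by norm_num,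
      by norm_num, ?_⟩).1
    module
  obtain ⟨ε, hε, hball⟩ := Metric.isOpen_iff.1 ho _ huΩ
  refine mem_intrinsicInterior_recessionDirections_iff.2 ⟨ε, hε, fun e he hen => ?_⟩
  have hmem : ξ + u + e ∈ Ω := hball (by simpa [mem_ball_iff_norm] using hen)
  have := hslice _ (subset_closure hmem) (by
    have := add_mem (Submodule.subset_span hu) he
    rwa [add_assoc, add_sub_cancel_left])
  rwa [hpξ, add_assoc, add_sub_cancel_left] at this
end
end

section
/- Let Ω be a quasi-homogeneous properly convex affine domain in ℝⁿ and let S be the set of extreme points of the closure of Ω. If the closure of Ω equals the closure of the convex hull of S, then no face of Ω contained in the boundary ∂Ω is conic, and Aut(Ω) is irreducible. -/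
open Matrix Set Filter Topology Pointwise

noncomputable section

/-- The face relation on the closure of Ω: x ∼ y iff x = y or some open segment inside
the closure of Ω contains both x and y. -/
def FaceRel (n : ℕ) (Ω : Set (Fin n → ℝ)) (x y : Fin n → ℝ) : Prop :=
  x = y ∨ ∃ a b : Fin n → ℝ, openSegment ℝ a b ⊆ closure Ω ∧
    x ∈ openSegment ℝ a b ∧ y ∈ openSegment ℝ a b

/-- A face of Ω is an equivalence class of the face relation on the closure of Ω. -/
def IsFace (n : ℕ) (Ω F : Set (Fin n → ℝ)) : Prop :=
  ∃ x ∈ closure Ω, F = {y ∈ closure Ω | FaceRel n Ω x y}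

/-- A supporting hyperplane of Ω: an affine hyperplane meeting the closure of Ω such
that Ω lies in one of the two closed half-spaces it bounds. -/
def IsSupportingHyperplane (n : ℕ) (Ω H : Set (Fin n → ℝ)) : Prop :=
  ∃ (f : (Fin n → ℝ) →ₗ[ℝ] ℝ) (c : ℝ), f ≠ 0 ∧ H = {x | f x = c} ∧
    (H ∩ closure Ω).Nonempty ∧ ((∀ x ∈ Ω, f x ≤ c) ∨ (∀ x ∈ Ω, c ≤ f x))

/-- Intersection of the hyperplanes H₁, …, H_{m+1} (0-indexed: those with index ≤ m). -/
def chainInter {n N : ℕ} (H : Fin N → Set (Fin n → ℝ)) (m : ℕ) : Set (Fin n → ℝ) :=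
  ⋂ i : Fin N, ⋂ _ : (i : ℕ) ≤ m, H i

/-- A face F of Ω of dimension k is conic if there are n − k supporting hyperplanes
H₁, …, H_{n−k} with H₁ ⊋ H₁ ∩ H₂ ⊋ ⋯ ⊋ H₁ ∩ ⋯ ∩ H_{n−k} = affine span of F. -/
def IsConicFace (n : ℕ) (Ω F : Set (Fin n → ℝ)) : Prop :=
  IsFace n Ω F ∧
    ∃ H : Fin (n - Module.finrank ℝ (affineSpan ℝ F).direction) → Set (Fin n → ℝ),
      (∀ i, IsSupportingHyperplane n Ω (H i)) ∧
      (∀ m : ℕ, m + 1 < n - Module.finrank ℝ (affineSpan ℝ F).direction →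
        chainInter H (m + 1) ⊂ chainInter H m) ∧
      chainInter H (n - Module.finrank ℝ (affineSpan ℝ F).direction - 1)
        = (affineSpan ℝ F : Set (Fin n → ℝ))

section QuasiHomogeneous

variable {E : Type*} [NormedAddCommGroup E] [NormedSpace ℝ E]

/-- A convex set containing a pair of points `y ± v` contains the points between them. -/
theorem Convex.add_smul_mem_of_abs_le_one {C : Set E} (hC : Convex ℝ C) {y v : E}
    (h₁ : y + v ∈ C) (h₂ : y - v ∈ C) {c : ℝ} (hc : |c| ≤ 1) : y + c • v ∈ C := by
  rw [abs_le] at hc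
  have := hC h₁ h₂ (show 0 ≤ (1 + c) / 2 by linarith) (show 0 ≤ (1 - c) / 2 by linarith) (by ring)
  convert this using 1
  module

/-- If an open convex set contains no line, then neither does its closure. -/
theorem Convex.closure_no_line {Ω : Set E} (hc : Convex ℝ Ω) (ho : IsOpen Ω) (hne : Ω.Nonempty)
    (hline : ¬ ∃ x ∈ Ω, ∃ v : E, v ≠ 0 ∧ ∀ t : ℝ, x + t • v ∈ Ω) {p v : E}
    (h : ∀ t : ℝ, p + t • v ∈ closure Ω) : v = 0 := by
  by_contra hv
  obtain ⟨x, hx⟩ := hne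
  refine hline ⟨x, hx, v, hv, fun t => ?_⟩
  have key : ∀ t : ℝ, x + t • v ∈ closure Ω := fun t => by
    have hlim : Tendsto (fun k : ℕ => x + t • v + (1 / ((k : ℝ) + 1)) • (p - x)) atTop
        (𝓝 (x + t • v + (0 : ℝ) • (p - x))) :=
      tendsto_const_nhds.add (tendsto_one_div_add_atTop_nhds_zero_nat.smul_const _)
    rw [zero_smul, add_zero] at hlim
    refine isClosed_closure.mem_of_tendsto hlim (Eventually.of_forall fun k => ?_)
    have hk : (0 : ℝ) < (k : ℝ) + 1 := by positivity
    have := hc.closure (subset_closure hx) (h ((k + 1) * t))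
      (show 0 ≤ 1 - 1 / ((k : ℝ) + 1) by
        rw [sub_nonneg, div_le_one hk]; linarith [(Nat.cast_nonneg k : (0 : ℝ) ≤ k)])
      (show 0 ≤ 1 / ((k : ℝ) + 1) by positivity) (by ring)
    convert this using 1
    rw [smul_add, smul_smul, ← mul_assoc, one_div_mul_cancel hk.ne']
    module
  have := hc.openSegment_interior_closure_subset_interior (x := x) (y := x + (2 * t) • v)
    (by rwa [ho.interior_eq]) (key _)
  rw [ho.interior_eq] at this
  refine this ⟨1 / 2, 1 / 2, by norm_num, by norm_num, by norm_num, ?_⟩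
  module

variable [FiniteDimensional ℝ E]

/-- In a closed convex set without lines, the symmetric segments centred at the points of a
bounded set have bounded length. -/
theorem exists_norm_le_of_no_line {C B : Set E} (hC : Convex ℝ C) (hCc : IsClosed C)
    (hline : ∀ p v : E, (∀ t : ℝ, p + t • v ∈ C) → v = 0) (hB : Bornology.IsBounded B) :
    ∃ R : ℝ, ∀ y ∈ B, ∀ v : E, y + v ∈ C → y - v ∈ C → ‖v‖ ≤ R := by
  by_contra! hcon
  choose y hyB v h₁ h₂ hv using fun k : ℕ => hcon (k : ℝ)
  have : ProperSpace E := FiniteDimensional.proper ℝ E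
  have hpos : ∀ k, 0 < ‖v k‖ := fun k => (Nat.cast_nonneg k).trans_lt (hv k)
  have hmem : ∀ k, (y k, ‖v k‖⁻¹ • v k) ∈ closure B ×ˢ Metric.sphere (0 : E) 1 := fun k =>
    ⟨subset_closure (hyB k), by simp [norm_smul, (hpos k).ne']⟩
  obtain ⟨⟨p, e⟩, ⟨-, he⟩, φ, hφ, hlim⟩ :=
    (hB.isCompact_closure.prod (isCompact_sphere (0 : E) 1)).tendsto_subseq hmem
  rw [nhds_prod_eq, tendsto_prod_iff'] at hlim
  have he0 : e = 0 := hline p e fun t => by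
    refine hCc.mem_of_tendsto (hlim.1.add (hlim.2.const_smul t)) ?_
    filter_upwards [(tendsto_natCast_atTop_atTop.comp hφ.tendsto_atTop).eventually_ge_atTop |t|]
      with k hk
    have := hC.add_smul_mem_of_abs_le_one (h₁ (φ k)) (h₂ (φ k)) (c := t * ‖v (φ k)‖⁻¹) (by
      rw [abs_mul, abs_inv, abs_norm, ← div_eq_mul_inv, div_le_one (hpos _)]
      exact hk.trans (hv _).le)
    simpa [mul_smul] using this
  simp [he0] at he

/-- Every point of `Ω` is the image of a point of `K` under an affine automorphism of `Ω`. -/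
def AffineQuasiHomogeneous (Ω K : Set E) : Prop :=
  ∀ x ∈ Ω, ∃ y ∈ K, ∃ L : E ≃L[ℝ] E, ∀ z, x + L (z - y) ∈ Ω ↔ z ∈ Ω

omit [FiniteDimensional ℝ E] in
theorem mem_closure_iff_of_affine {Ω : Set E} {x y : E} {L : E ≃L[ℝ] E}
    (h : ∀ z, x + L (z - y) ∈ Ω ↔ z ∈ Ω) (z : E) :
    x + L (z - y) ∈ closure Ω ↔ z ∈ closure Ω := by
  let e : E ≃ₜ E :=
    (Homeomorph.addRight (-y)).trans (L.toHomeomorph.trans (Homeomorph.addLeft x))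
  have he : ∀ z, e z = x + L (z - y) := fun z => by simp [e, sub_eq_add_neg]
  have hpre : e ⁻¹' Ω = Ω := by
    ext z
    rw [mem_preimage, he, h]
  have := e.preimage_closure Ω
  rw [hpre] at this
  rw [← he, ← mem_preimage, this]

omit [NormedSpace ℝ E] [FiniteDimensional ℝ E] in
theorem IsCompact.exists_pos_add_mem {Ω K : Set E} (hK : IsCompact K) (ho : IsOpen Ω)
    (hKΩ : K ⊆ Ω) : ∃ δ > 0, ∀ y ∈ K, ∀ v : E, ‖v‖ ≤ δ → y + v ∈ Ω := by
  obtain ⟨δ, hδ, h⟩ := hK.exists_cthickening_subset_open ho hKΩ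
  refine ⟨δ, hδ, fun y hy v hv => h ?_⟩
  exact Metric.mem_cthickening_of_dist_le _ y _ _ hy (by simpa using hv)

omit [FiniteDimensional ℝ E] in
/-- A linear map bounded by `R` on the ball of radius `δ` has norm at most `R / δ`. -/
theorem ContinuousLinearMap.opNorm_le_div_of_ball {F : Type*} [NormedAddCommGroup F]
    [NormedSpace ℝ F] {T : E →L[ℝ] F} {δ R : ℝ} (hδ : 0 < δ)
    (h : ∀ v, ‖v‖ ≤ δ → ‖T v‖ ≤ R) : ‖T‖ ≤ R / δ := by
  have hR : 0 ≤ R := (norm_nonneg _).trans (h 0 (by simpa using hδ.le))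
  refine T.opNorm_le_bound (by positivity) fun v => ?_
  rcases eq_or_ne v 0 with rfl | hv
  · simp
  have hv' : 0 < ‖v‖ := norm_pos_iff.2 hv
  have := h ((δ / ‖v‖) • v) (by
    rw [norm_smul, Real.norm_of_nonneg (by positivity), div_mul_cancel₀ _ hv'.ne'])
  rw [map_smul, norm_smul, Real.norm_of_nonneg (by positivity)] at this
  rw [div_mul_eq_mul_div, le_div_iff₀ hδ]
  rw [div_mul_eq_mul_div, div_le_iff₀ hv'] at this
  linarith

omit [FiniteDimensional ℝ E] in
theorem Filter.Tendsto.clm_apply_apply {F ι : Type*} [NormedAddCommGroup F] [NormedSpace ℝ F]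
    {l : Filter ι} {T : ι → E →L[ℝ] F} {v : ι → E} {T₀ : E →L[ℝ] F} {v₀ : E}
    (hT : Tendsto T l (𝓝 T₀)) (hv : Tendsto v l (𝓝 v₀)) :
    Tendsto (fun i => T i (v i)) l (𝓝 (T₀ v₀)) :=
  (isBoundedBilinearMap_apply.continuous.tendsto (T₀, v₀)).comp (hT.prodMk_nhds hv)

/-- Automorphisms of a quasi-homogeneous domain can contract it to any extreme point `p`. -/
theorem extremePoint_mem_of_quasiHomogeneous {Ω K S : Set E} (hc : Convex ℝ Ω) (ho : IsOpen Ω)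
    (hne : Ω.Nonempty) (hline : ¬ ∃ x ∈ Ω, ∃ v : E, v ≠ 0 ∧ ∀ t : ℝ, x + t • v ∈ Ω)
    (hK : IsCompact K) (hKΩ : K ⊆ Ω) (hS : IsClosed S) (hSne : S.Nonempty)
    (hqh : ∀ x ∈ Ω, ∃ y ∈ K, ∃ L : E ≃L[ℝ] E, (∀ z, x + L (z - y) ∈ Ω ↔ z ∈ Ω) ∧
      ∀ z ∈ S, x + L (z - y) ∈ S)
    {p : E} (hp : p ∈ extremePoints ℝ (closure Ω)) : p ∈ S := by
  have : ProperSpace E := FiniteDimensional.proper ℝ E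
  obtain ⟨z₀, hz₀⟩ := hne
  have hx : ∀ k : ℕ, p + (1 / ((k : ℝ) + 1)) • (z₀ - p) ∈ Ω := fun k => by
    have hk : (0 : ℝ) < (k : ℝ) + 1 := by positivity
    have := hc.add_smul_sub_mem_interior' hp.1 (by rwa [ho.interior_eq])
      (t := 1 / ((k : ℝ) + 1)) ⟨by positivity, by
        rw [div_le_one hk]; linarith [(Nat.cast_nonneg k : (0 : ℝ) ≤ k)]⟩
    rwa [ho.interior_eq] at this
  have hxlim : Tendsto (fun k : ℕ => p + (1 / ((k : ℝ) + 1)) • (z₀ - p)) atTop (𝓝 p) := by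
    have := tendsto_const_nhds (x := p) |>.add
      ((tendsto_one_div_add_atTop_nhds_zero_nat (𝕜 := ℝ)).smul_const (z₀ - p))
    simpa using this
  set x := fun k : ℕ => p + (1 / ((k : ℝ) + 1)) • (z₀ - p)
  choose y hyK L hL hLS using fun k => hqh (x k) (hx k)
  obtain ⟨δ, hδ, hball⟩ := hK.exists_pos_add_mem ho hKΩ
  have hmem : ∀ k v, ‖v‖ ≤ δ → x k + L k v ∈ Ω := fun k v hv => by
    have := (hL k (y k + v)).2 (hball _ (hyK k) v hv)
    rwa [add_sub_cancel_left] at this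
  obtain ⟨R, hR⟩ := exists_norm_le_of_no_line hc.closure isClosed_closure
    (fun p v h => hc.closure_no_line ho ⟨z₀, hz₀⟩ hline h)
    (Metric.isBounded_range_of_tendsto x hxlim)
  have hLbd : ∀ k, ‖(L k : E →L[ℝ] E)‖ ≤ R / δ := fun k =>
    ContinuousLinearMap.opNorm_le_div_of_ball hδ fun v hv =>
      hR _ (mem_range_self k) _ (subset_closure (hmem k v hv)) (subset_closure (by
        have := hmem k (-v) (by rwa [norm_neg])
        rwa [map_neg, ← sub_eq_add_neg] at this))
  obtain ⟨⟨y', T⟩, -, φ, hφ, hlim⟩ :=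
    (hK.prod (isCompact_closedBall (0 : E →L[ℝ] E) (R / δ))).tendsto_subseq
      (x := fun k => (y k, (L k : E →L[ℝ] E))) fun k => ⟨hyK k, by simpa using hLbd k⟩
  rw [nhds_prod_eq, tendsto_prod_iff'] at hlim
  obtain ⟨hylim, hTlim⟩ := hlim
  have hxφ := hxlim.comp hφ.tendsto_atTop
  have hpT : ∀ v, ‖v‖ ≤ δ → p + T v ∈ closure Ω := fun v hv =>
    isClosed_closure.mem_of_tendsto (hxφ.add (hTlim.clm_apply_apply tendsto_const_nhds))
      (Eventually.of_forall fun k => subset_closure (hmem (φ k) v hv))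
  have hT0 : T = 0 := by
    refine norm_le_zero_iff.1 ?_
    rw [← zero_div δ]
    refine ContinuousLinearMap.opNorm_le_div_of_ball hδ fun v hv => ?_
    have := hp.2 (hpT v hv) (hpT (-v) (by rwa [norm_neg]))
      ⟨1 / 2, 1 / 2, by norm_num, by norm_num, by norm_num, by rw [map_neg]; module⟩
    simpa using this
  obtain ⟨s, hs⟩ := hSne
  have hlimS := hxφ.add (hTlim.clm_apply_apply ((tendsto_const_nhds (x := s)).sub hylim))
  rw [hT0, _root_.zero_apply, add_zero] at hlimS
  exact hS.mem_of_tendsto hlimS (Eventually.of_forall fun k => hLS (φ k) s hs)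

omit [FiniteDimensional ℝ E] in
/-- If all extreme points of `closure Ω` lie in the closed convex set `S`, so does `Ω`. -/
theorem subset_of_extremePoints_subset {Ω S : Set E}
    (hull : closure Ω ⊆ closure (convexHull ℝ (extremePoints ℝ (closure Ω))))
    (hS : Convex ℝ S) (hSc : IsClosed S) (h : extremePoints ℝ (closure Ω) ⊆ S) : Ω ⊆ S :=
  subset_closure.trans (hull.trans (hSc.closure_subset_iff.2 (convexHull_min h hS)))

/-- A quasi-inverse of a linear map between finite-dimensional spaces. -/
theorem ContinuousLinearMap.exists_quasiInverse {F : Type*} [NormedAddCommGroup F]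
    [NormedSpace ℝ F] [FiniteDimensional ℝ F] (Φ : E →L[ℝ] F) :
    ∃ Ψ : F →L[ℝ] E, ∀ v, Φ (Ψ (Φ v)) = Φ v := by
  obtain ⟨g, hg⟩ := (Φ : E →ₗ[ℝ] F).rangeRestrict.exists_rightInverse_of_surjective
    (LinearMap.range_rangeRestrict _)
  obtain ⟨G, hG⟩ := g.exists_extend
  refine ⟨LinearMap.toContinuousLinearMap G, fun v => ?_⟩
  have h₁ := LinearMap.congr_fun hG ((Φ : E →ₗ[ℝ] F).rangeRestrict v)
  have h₂ := congrArg Subtype.val (LinearMap.congr_fun hg ((Φ : E →ₗ[ℝ] F).rangeRestrict v))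
  rw [LinearMap.comp_apply, ← h₁] at h₂
  simpa using h₂

/-- Dilation by the factor `t` along the range of `Q`, fixing the kernel of `Q`. -/
def partialDilation (Q : E →L[ℝ] E) (t : ℝ) : E →L[ℝ] E := t • Q + (1 - Q)

omit [FiniteDimensional ℝ E] in
theorem partialDilation_apply (Q : E →L[ℝ] E) (t : ℝ) (v : E) :
    partialDilation Q t v = t • Q v + (v - Q v) := rfl

omit [FiniteDimensional ℝ E] in
theorem partialDilation_mul {Q : E →L[ℝ] E} (hQ : ∀ v, Q (Q v) = Q v) (s t : ℝ) (v : E) :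
    partialDilation Q s (partialDilation Q t v) = partialDilation Q (s * t) v := by
  simp only [partialDilation_apply, map_add, map_sub, map_smul, hQ]
  module

/-- If a quasi-homogeneous domain whose closure is the closed convex hull of its extreme points
lies, relative to a boundary point `x₀`, in the cone `Φ ≤ 0`, and is a neighbourhood of `x₀` in
the directions of `ker Φ`, then `Φ = 0`. -/
theorem AffineQuasiHomogeneous.eq_zero_of_cone {Ω K : Set E} (hc : Convex ℝ Ω) (ho : IsOpen Ω)
    (hne : Ω.Nonempty) (hline : ¬ ∃ x ∈ Ω, ∃ v : E, v ≠ 0 ∧ ∀ t : ℝ, x + t • v ∈ Ω)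
    (hK : IsCompact K) (hKΩ : K ⊆ Ω) (hqh : AffineQuasiHomogeneous Ω K)
    (hull : closure Ω ⊆ closure (convexHull ℝ (extremePoints ℝ (closure Ω))))
    {ι : Type*} [Fintype ι] {Φ : E →L[ℝ] (ι → ℝ)} {x₀ : E} {r : ℝ} (hr : 0 < r)
    (hball : ∀ v, Φ v = 0 → ‖v‖ < r → x₀ + v ∈ closure Ω)
    (hcone : ∀ v, x₀ + v ∈ Ω → Φ v ≤ 0) : Φ = 0 := by
  have : ProperSpace E := FiniteDimensional.proper ℝ E
  have hline' : ∀ p v : E, (∀ t : ℝ, p + t • v ∈ closure Ω) → v = 0 :=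
    fun p v h => hc.closure_no_line ho hne hline h
  obtain ⟨Ψ, hΨ⟩ := Φ.exists_quasiInverse
  set Q : E →L[ℝ] E := Ψ ∘L Φ with hQdef
  have hQ : ∀ v, Q (Q v) = Q v := fun v => by simp [hQdef, hΨ]
  have hΦQ : ∀ v, Φ (Q v) = Φ v := fun v => by simp [hQdef, hΨ]
  set D := partialDilation Q with hD
  have hDapp : ∀ t v, D t v = t • Q v + (v - Q v) := partialDilation_apply Q
  have hΦD : ∀ t v, Φ (D t v) = t • Φ v := fun t v => by simp [hDapp, hΦQ]
  have hDcont : Continuous D := by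
    exact (continuous_id.smul continuous_const).add continuous_const
  -- `Ω` contains all partial contractions of a neighbourhood of some point `x₀ + u`
  obtain ⟨u, η, hη, hu⟩ : ∃ u : E, ∃ η > 0, ∀ v, ‖v‖ ≤ η → ∀ t : ℝ, 0 < t → t ≤ 1 →
      x₀ + D t (u + v) ∈ Ω := by
    have hx₀ : x₀ ∈ closure Ω := by simpa using hball 0 (by simp) (by simpa using hr)
    have hQr : IsOpen {v : E | ‖v - Q v‖ < r} := isOpen_lt (by fun_prop) continuous_const
    have hWo : IsOpen {v : E | x₀ + v ∈ Ω ∧ ‖v - Q v‖ < r} :=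
      (ho.preimage (continuous_const_add x₀)).inter hQr
    obtain ⟨z, hz⟩ := hne
    have hcl : (0 : E) ∈ closure {v : E | x₀ + v ∈ Ω} := by
      have := (Homeomorph.addLeft x₀).preimage_closure Ω
      have h0 : (0 : E) ∈ (Homeomorph.addLeft x₀) ⁻¹' closure Ω := by simpa using hx₀
      rw [this] at h0
      exact h0
    obtain ⟨u, hu₁, hu₂⟩ := mem_closure_iff.1 hcl {v : E | ‖v - Q v‖ < r}
      hQr (by simpa using hr)
    obtain ⟨η, hη, hsub⟩ := Metric.nhds_basis_closedBall.mem_iff.1 (hWo.mem_nhds ⟨hu₂, hu₁⟩)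
    refine ⟨u, η, hη, fun v hv t ht ht1 => ?_⟩
    obtain ⟨hw₁, hw₂⟩ := hsub (show u + v ∈ Metric.closedBall u η by simpa using hv)
    have := hc.add_smul_sub_mem_interior' (hball (u + v - Q (u + v)) (by simp [hΦQ]) hw₂)
      (by rwa [ho.interior_eq] : x₀ + (u + v) ∈ interior Ω) ⟨ht, ht1⟩
    rw [ho.interior_eq] at this
    convert this using 1
    rw [hDapp]
    module
  obtain ⟨δ, hδ, hKball⟩ := hK.exists_pos_add_mem ho hKΩ
  set t : ℕ → ℝ := fun k => 1 / ((k : ℝ) + 1) with ht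
  have htpos : ∀ k, 0 < t k := fun k => by positivity
  have htle : ∀ k, t k ≤ 1 := fun k => by
    rw [ht, div_le_one (by positivity)]; linarith [(Nat.cast_nonneg k : (0 : ℝ) ≤ k)]
  have htlim : Tendsto t atTop (𝓝 0) := tendsto_one_div_add_atTop_nhds_zero_nat
  have hx : ∀ k, x₀ + D (t k) u ∈ Ω := fun k => by
    simpa using hu 0 (by simpa using hη.le) (t k) (htpos k) (htle k)
  choose y hyK L hL using fun k => hqh _ (hx k)
  have hLmem : ∀ k v, ‖v‖ ≤ δ → x₀ + D (t k) u + L k v ∈ Ω := fun k v hv => by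
    have := (hL k (y k + v)).2 (hKball _ (hyK k) v hv)
    rwa [add_sub_cancel_left] at this
  have hLmem' : ∀ k v, ‖v‖ ≤ δ → x₀ + D (t k) u - L k v ∈ Ω := fun k v hv => by
    have := hLmem k (-v) (by rwa [norm_neg])
    rwa [map_neg, ← sub_eq_add_neg] at this
  -- bounds for the rescaled linear parts and for their inverses
  obtain ⟨R₁, hR₁⟩ := exists_norm_le_of_no_line hc.closure isClosed_closure hline'
    (Metric.isBounded_range_of_tendsto (fun k => x₀ + D (t k) u)
      (tendsto_const_nhds.add (((hDcont.tendsto 0).comp htlim).clm_apply_apply tendsto_const_nhds)))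
  have hL1 : ∀ k v, ‖v‖ ≤ δ → ‖L k v‖ ≤ R₁ := fun k v hv =>
    hR₁ _ (mem_range_self k) _ (subset_closure (hLmem k v hv)) (subset_closure (hLmem' k v hv))
  have hL2 : ∀ k v, ‖v‖ ≤ δ → ‖(t k)⁻¹ • Φ (L k v)‖ ≤ ‖Φ u‖ := fun k v hv => by
    have h₁ := hcone _ (by simpa only [add_assoc] using hLmem k v hv)
    have h₂ := hcone _ (by simpa only [add_sub_assoc] using hLmem' k v hv)
    rw [map_add, hΦD] at h₁
    rw [map_sub, hΦD] at h₂
    rw [norm_smul, norm_inv, Real.norm_of_nonneg (htpos k).le, inv_mul_le_iff₀ (htpos k),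
      pi_norm_le_iff_of_nonneg (mul_nonneg (htpos k).le (norm_nonneg _))]
    intro i
    have h₁' := h₁ i
    have h₂' := h₂ i
    simp only [Pi.add_apply, Pi.sub_apply, Pi.smul_apply, smul_eq_mul, Pi.zero_apply] at h₁' h₂'
    have h₃ := mul_le_mul_of_nonneg_left ((neg_le_abs _).trans (norm_le_pi_norm (Φ u) i))
      (htpos k).le
    rw [Real.norm_eq_abs, abs_le]
    constructor <;> linarith
  set Λ : ℕ → E →L[ℝ] E := fun k => D (t k)⁻¹ ∘L (L k : E →L[ℝ] E) with hΛ
  set M : ℕ → E →L[ℝ] E := fun k => ((L k).symm : E →L[ℝ] E) ∘L D (t k) with hM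
  have hMΛ : ∀ k, M k ∘L Λ k = ContinuousLinearMap.id ℝ E := fun k => by
    ext v
    have h1 : ∀ w, partialDilation Q 1 w = w := fun w => by simp [partialDilation_apply]
    simp only [hM, hΛ, hD, ContinuousLinearMap.comp_apply, ContinuousLinearEquiv.coe_coe,
      partialDilation_mul hQ, mul_inv_cancel₀ (htpos k).ne', h1,
      ContinuousLinearEquiv.symm_apply_apply, ContinuousLinearMap.id_apply]
  have hΛM : ∀ k, Λ k ∘L M k = ContinuousLinearMap.id ℝ E := fun k => by
    ext v
    have h1 : ∀ w, partialDilation Q 1 w = w := fun w => by simp [partialDilation_apply]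
    simp only [hM, hΛ, hD, ContinuousLinearMap.comp_apply, ContinuousLinearEquiv.coe_coe,
      ContinuousLinearEquiv.apply_symm_apply, partialDilation_mul hQ,
      inv_mul_cancel₀ (htpos k).ne', h1, ContinuousLinearMap.id_apply]
  have hΛbd : ∀ k, ‖Λ k‖ ≤ (‖Ψ‖ * ‖Φ u‖ + (R₁ + ‖Q‖ * R₁)) / δ := fun k =>
    ContinuousLinearMap.opNorm_le_div_of_ball hδ fun v hv => by
      have heq : Λ k v = Ψ ((t k)⁻¹ • Φ (L k v)) + (L k v - Q (L k v)) := by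
        simp [hΛ, hDapp, hQdef]
      rw [heq]
      refine (norm_add_le _ _).trans (add_le_add ?_ ((norm_sub_le _ _).trans (add_le_add ?_ ?_)))
      · exact (Ψ.le_opNorm _).trans (by gcongr; exact hL2 k v hv)
      · exact hL1 k v hv
      · exact (Q.le_opNorm _).trans (by gcongr; exact hL1 k v hv)
  obtain ⟨R₂, hR₂⟩ := exists_norm_le_of_no_line hc.closure isClosed_closure hline' hK.isBounded
  have hpull : ∀ k v, x₀ + D (t k) (u + v) ∈ closure Ω → y k + M k v ∈ closure Ω :=
    fun k v hv => (mem_closure_iff_of_affine (hL k) _).1 (by simpa [hM, add_assoc] using hv)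
  have hMbd : ∀ k, ‖M k‖ ≤ R₂ / η := fun k =>
    ContinuousLinearMap.opNorm_le_div_of_ball hη fun v hv =>
      hR₂ _ (hyK k) _ (hpull k v (subset_closure (hu v hv _ (htpos k) (htle k)))) (by
        have := hpull k (-v) (subset_closure
          (hu (-v) (by rwa [norm_neg]) _ (htpos k) (htle k)))
        rwa [map_neg, ← sub_eq_add_neg] at this)
  obtain ⟨⟨y', Λ', M'⟩, -, φ, hφ, hlim⟩ :=
    (hK.prod ((isCompact_closedBall (0 : E →L[ℝ] E) _).prod
      (isCompact_closedBall (0 : E →L[ℝ] E) _))).tendsto_subseq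
      (x := fun k => (y k, Λ k, M k)) fun k =>
        ⟨hyK k, mem_closedBall_zero_iff.2 (hΛbd k), mem_closedBall_zero_iff.2 (hMbd k)⟩
  simp only [nhds_prod_eq, tendsto_prod_iff'] at hlim
  obtain ⟨hylim, hΛlim, hMlim⟩ := hlim
  have htφ := htlim.comp hφ.tendsto_atTop
  have hMΛ' : M' ∘L Λ' = ContinuousLinearMap.id ℝ E :=
    tendsto_nhds_unique
      ((isBoundedBilinearMap_comp.continuous.tendsto (M', Λ')).comp (hMlim.prodMk_nhds hΛlim))
      (tendsto_const_nhds.congr fun k => (hMΛ (φ k)).symm)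
  have hΛM' : Λ' ∘L M' = ContinuousLinearMap.id ℝ E :=
    tendsto_nhds_unique
      ((isBoundedBilinearMap_comp.continuous.tendsto (Λ', M')).comp (hΛlim.prodMk_nhds hMlim))
      (tendsto_const_nhds.congr fun k => (hΛM (φ k)).symm)
  -- the limit of the rescaled domains is invariant under partial dilations
  have hinv : ∀ s : ℝ, 0 ≤ s → ∀ x ∈ closure Ω,
      y' + M' (D s (u + Λ' (x - y')) - u) ∈ closure Ω := by
    intro s hs
    have hcont : Continuous fun x => y' + M' (D s (u + Λ' (x - y')) - u) := by fun_prop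
    suffices h : ∀ x ∈ Ω, y' + M' (D s (u + Λ' (x - y')) - u) ∈ closure Ω from
      fun x hx => closure_minimal h (isClosed_closure.preimage hcont) hx
    intro x hx
    set a := u + Λ' (x - y') with ha
    have hlim₁ : Tendsto (fun k => y (φ k) + M (φ k) (a - u)) atTop (𝓝 x) := by
      have := hylim.add (hMlim.clm_apply_apply (tendsto_const_nhds (x := a - u)))
      have hx' : M' (a - u) = x - y' := by
        rw [ha, add_sub_cancel_left]
        exact DFunLike.congr_fun hMΛ' (x - y')
      rwa [hx', add_sub_cancel] at this
    have hev : ∀ᶠ k in atTop, x₀ + D (t (φ k)) a ∈ Ω := by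
      filter_upwards [hlim₁.eventually (ho.mem_nhds hx)] with k hk
      replace hk := (hL (φ k) _).2 hk
      simpa [hM, add_assoc] using hk
    have hzero : x₀ + D 0 a ∈ closure Ω :=
      mem_closure_of_tendsto (tendsto_const_nhds.add
        (((hDcont.tendsto 0).comp htφ).clm_apply_apply tendsto_const_nhds)) hev
    obtain ⟨k₀, hk₀⟩ := hev.exists
    have hsmall : ∀ᶠ k in atTop, x₀ + D (t (φ k)) (D s a) ∈ closure Ω := by
      have : Tendsto (fun k => t (φ k) * s) atTop (𝓝 0) := by simpa using htφ.mul_const s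
      filter_upwards [this.eventually (gt_mem_nhds (htpos (φ k₀)))] with k hk
      have hτ := htpos (φ k₀)
      have := hc.closure (subset_closure hk₀) hzero
        (show 0 ≤ t (φ k) * s / t (φ k₀) from
          div_nonneg (mul_nonneg (htpos _).le hs) hτ.le)
        (show 0 ≤ 1 - t (φ k) * s / t (φ k₀) by
          rw [sub_nonneg, div_le_one hτ]; exact hk.le) (by ring)
      convert this using 1
      rw [hD, partialDilation_mul hQ]
      simp only [partialDilation_apply, smul_add, smul_smul]
      rw [div_mul_cancel₀ _ hτ.ne']
      module
    refine isClosed_closure.mem_of_tendsto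
      (hylim.add (hMlim.clm_apply_apply (tendsto_const_nhds (x := D s a - u)))) ?_
    filter_upwards [hsmall] with k hk
    exact hpull (φ k) _ (by rwa [add_sub_cancel])
  have hext : extremePoints ℝ (closure Ω) ⊆ {x | Q (u + Λ' (x - y')) = 0} := by
    intro e he
    have he' : y' + M' (u + Λ' (e - y') - u) = e := by
      rw [add_sub_cancel_left]
      have := DFunLike.congr_fun hMΛ' (e - y')
      simp only [ContinuousLinearMap.comp_apply, ContinuousLinearMap.id_apply] at this
      rw [this, add_sub_cancel]
    have h0 := hinv 0 le_rfl e he.1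
    have h2 := hinv 2 zero_le_two e he.1
    set a := u + Λ' (e - y') with ha
    have hmid : y' + M' (D 0 a - u) = e := he.2 h0 h2
      ⟨1 / 2, 1 / 2, by norm_num, by norm_num, by norm_num, by
        rw [← he']
        simp only [hDapp, map_add, map_sub, map_smul]
        module⟩
    have hMQ : M' (Q a) = 0 := by
      rw [← he'] at hmid
      simp only [hDapp, map_add, map_sub, map_zero, zero_smul] at hmid
      have := sub_eq_zero.2 hmid
      rw [← neg_eq_zero, ← this]
      module
    have := congrArg Λ' hMQ
    rw [map_zero] at this
    rw [mem_ofPred_eq, ← this]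
    exact (DFunLike.congr_fun hΛM' (Q a)).symm
  have hsub : Ω ⊆ {x | Q (u + Λ' (x - y')) = 0} := by
    refine subset_of_extremePoints_subset hull ?_ ?_ hext
    · intro x hx z hz a b _ _ hab
      simp only [mem_ofPred_eq] at hx hz ⊢
      have : u + Λ' (a • x + b • z - y') = a • (u + Λ' (x - y')) + b • (u + Λ' (z - y')) := by
        obtain rfl : b = 1 - a := by linarith
        simp only [map_add, map_sub, map_smul]
        module
      rw [this, map_add, map_smul, map_smul, hx, hz, smul_zero, smul_zero, add_zero]
    · exact isClosed_eq (by fun_prop) continuous_const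
  obtain ⟨y₀, hy₀⟩ : K.Nonempty := ⟨_, hyK 0⟩
  have hQΛ : Q ∘L Λ' = 0 := by
    refine norm_le_zero_iff.1 ?_
    rw [← zero_div δ]
    refine ContinuousLinearMap.opNorm_le_div_of_ball hδ fun v hv => ?_
    have h₁ : Q (u + Λ' (y₀ - y')) = 0 := hsub (hKΩ hy₀)
    have h₂ : Q (u + Λ' (y₀ + v - y')) = 0 := hsub (hKball _ hy₀ v hv)
    have : Q (Λ' v) = Q (u + Λ' (y₀ + v - y')) - Q (u + Λ' (y₀ - y')) := by
      rw [← map_sub, add_sub_add_left_eq_sub, ← map_sub, sub_sub_sub_cancel_right,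
        add_sub_cancel_left]
    rw [ContinuousLinearMap.comp_apply, this, h₁, h₂, sub_zero, norm_zero]
  ext1 v
  have h₁ := DFunLike.congr_fun hQΛ (M' v)
  have h₂ := DFunLike.congr_fun hΛM' v
  simp only [ContinuousLinearMap.comp_apply, ContinuousLinearMap.id_apply,
    _root_.zero_apply] at h₁ h₂
  rw [← hΦQ, ← h₂, h₁, map_zero, _root_.zero_apply]

end QuasiHomogeneous

theorem exists_affAct_eq_add {n : ℕ} {g : GL (Fin (n + 1)) ℝ} (hg : IsAffineForm n g) :
    ∃ L : (Fin n → ℝ) ≃L[ℝ] (Fin n → ℝ), ∀ x y, affAct n g x = affAct n g y + L (x - y) := by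
  set A : Matrix (Fin n) (Fin n) ℝ := Matrix.of fun i j => g.val i.castSucc j.castSucc with hA
  have hinj : Function.Injective A.mulVecLin := by
    rw [← LinearMap.ker_eq_bot, LinearMap.ker_eq_bot']
    intro v hv
    have h0 : g.val *ᵥ Fin.snoc (α := fun _ => ℝ) v 0 = 0 := by
      ext i
      refine Fin.lastCases ?_ (fun i => ?_) i
      · simp [Matrix.mulVec, dotProduct, Fin.sum_univ_castSucc, hg.1]
      · have := congrFun hv i
        simpa [Matrix.mulVec, dotProduct, Fin.sum_univ_castSucc, hA] using this
    have h1 := Matrix.mulVec_injective_of_isUnit g.isUnit (h0.trans (Matrix.mulVec_zero _).symm)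
    ext j
    simpa using congrFun h1 j.castSucc
  refine ⟨(LinearEquiv.ofInjectiveEndo A.mulVecLin hinj).toContinuousLinearEquiv, fun x y => ?_⟩
  ext i
  have : (LinearEquiv.ofInjectiveEndo A.mulVecLin hinj).toContinuousLinearEquiv (x - y) i =
      (∑ j : Fin n, g.val i.castSucc j.castSucc * x j) -
        ∑ j : Fin n, g.val i.castSucc j.castSucc * y j := by
    simp [Matrix.mulVec, dotProduct, hA, mul_sub]
  rw [Pi.add_apply, this]
  simp only [affAct]
  ring

theorem IsQuasiHomogeneous.exists_compact {n : ℕ} {Ω : Set (Fin n → ℝ)}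
    (h : IsQuasiHomogeneous n Ω) : ∃ K, IsCompact K ∧ K ⊆ Ω ∧ ∀ x ∈ Ω, ∃ y ∈ K,
      ∃ g ∈ AutSet n Ω, ∃ L : (Fin n → ℝ) ≃L[ℝ] (Fin n → ℝ),
        (∀ z, affAct n g z = x + L (z - y)) ∧ ∀ z, x + L (z - y) ∈ Ω ↔ z ∈ Ω := by
  obtain ⟨K, hK, hKΩ, hU⟩ := h
  refine ⟨K, hK, hKΩ, fun x hx => ?_⟩
  rw [← hU] at hx
  simp only [mem_iUnion] at hx
  obtain ⟨g, hg, y, hy, rfl⟩ := hx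
  obtain ⟨L, hL⟩ := exists_affAct_eq_add hg.1
  refine ⟨y, hy, g, hg, L, fun z => hL z y, fun z => ?_⟩
  have hinj : Function.Injective (affAct n g) := fun a b hab => by
    rw [hL a b, add_eq_left, map_eq_zero_iff _ L.injective, sub_eq_zero] at hab
    exact hab
  rw [← hL z y]
  nth_rw 1 [← hg.2]
  exact hinj.mem_set_image

theorem IsSupportingHyperplane.exists_le {n : ℕ} {Ω H : Set (Fin n → ℝ)}
    (h : IsSupportingHyperplane n Ω H) : ∃ (f : (Fin n → ℝ) →ₗ[ℝ] ℝ) (c : ℝ), f ≠ 0 ∧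
      (∀ x, x ∈ H ↔ f x = c) ∧ ∀ x ∈ Ω, f x ≤ c := by
  obtain ⟨f, c, hf, rfl, -, h | h⟩ := h
  · exact ⟨f, c, hf, fun x => Iff.rfl, h⟩
  · exact ⟨-f, -c, neg_ne_zero.2 hf, fun x => by simp, fun x hx => by simpa using h x hx⟩

/-- A face contained in the boundary does not span the whole space. -/
theorem IsFace.affineSpan_ne_univ {n : ℕ} {Ω F : Set (Fin n → ℝ)} (hΩ : IsConvexDomain n Ω)
    (hF : IsFace n Ω F) (hfr : F ⊆ frontier Ω) :
    (affineSpan ℝ F : Set (Fin n → ℝ)) ≠ univ := by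
  obtain ⟨⟨z, hz⟩, ho, hc⟩ := hΩ
  obtain ⟨x, hx, rfl⟩ := hF
  intro huniv
  have hxΩ : x ∉ Ω := fun h => by
    have := hfr ⟨hx, Or.inl rfl⟩
    rw [ho.frontier_eq] at this
    exact this.2 h
  obtain ⟨f, hf⟩ := geometric_hahn_banach_open_point hc ho hxΩ
  have hle : ∀ y ∈ closure Ω, f y ≤ f x := fun y hy =>
    closure_minimal (fun a ha => (hf a ha).le) (isClosed_le f.continuous continuous_const) hy
  have hsub : affineSpan ℝ {y | y ∈ closure Ω ∧ FaceRel n Ω x y} ≤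
      AffineSubspace.mk' x (LinearMap.ker (f : (Fin n → ℝ) →ₗ[ℝ] ℝ)) := by
    rw [affineSpan_le]
    rintro y ⟨-, rfl | ⟨a, b, hab, hxab, hyab⟩⟩
    · exact AffineSubspace.self_mem_mk' _ _
    rw [SetLike.mem_coe, AffineSubspace.mem_mk', LinearMap.mem_ker, vsub_eq_sub, map_sub,
      sub_eq_zero]
    have hseg : segment ℝ a b ⊆ closure Ω := by
      rw [← closure_openSegment]
      exact closure_minimal hab isClosed_closure
    have ha := hle a (hseg (left_mem_segment ℝ a b))
    have hb := hle b (hseg (right_mem_segment ℝ a b))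
    obtain ⟨s, t, hs, ht, hst, rfl⟩ := hxab
    obtain ⟨s', t', -, -, hst', rfl⟩ := hyab
    obtain rfl : t = 1 - s := by linarith
    obtain rfl : t' = 1 - s' := by linarith
    simp only [ContinuousLinearMap.coe_coe, map_add, map_smul, smul_eq_mul] at ha hb ⊢
    have hab' : f a = f b := by nlinarith
    rw [hab']
    ring
  have hz' : z ∈ (affineSpan ℝ {y | y ∈ closure Ω ∧ FaceRel n Ω x y} : Set (Fin n → ℝ)) := by
    rw [huniv]
    trivial
  have := hsub hz'
  rw [AffineSubspace.mem_mk', LinearMap.mem_ker, vsub_eq_sub, map_sub, sub_eq_zero] at this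
  exact (hf z hz).ne this

theorem not_isConicFace {n : ℕ} {Ω F : Set (Fin n → ℝ)} (h1 : IsProperlyConvexDomain n Ω)
    (h2 : IsQuasiHomogeneous n Ω)
    (hull : closure Ω ⊆ closure (convexHull ℝ (extremePoints ℝ (closure Ω))))
    (hF : IsFace n Ω F) (hfr : F ⊆ frontier Ω) : ¬ IsConicFace n Ω F := by
  rintro ⟨-, H, hH, -, hHF⟩
  choose f c hf0 hfH hfle using fun i => (hH i).exists_le
  have hspan : ∀ y, y ∈ affineSpan ℝ F ↔ ∀ i, f i y = c i := fun y => by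
    rw [← SetLike.mem_coe, ← hHF]
    simp only [chainInter, mem_iInter, hfH]
    exact ⟨fun h i => h i (by omega), fun h i _ => h i⟩
  set G : Set (Fin n → ℝ) := closure Ω ∩ affineSpan ℝ F with hG
  have hFG : F ⊆ G := fun y hy => ⟨frontier_subset_closure (hfr hy), subset_affineSpan ℝ F hy⟩
  have hFne : F.Nonempty := by
    obtain ⟨x, hx, rfl⟩ := hF
    exact ⟨x, hx, Or.inl rfl⟩
  obtain ⟨x₀, hx₀⟩ := (hFne.mono hFG).intrinsicInterior
    (h1.1.2.2.closure.inter (affineSpan ℝ F).convex)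
  have hx₀G := intrinsicInterior_subset hx₀
  rw [mem_intrinsicInterior] at hx₀
  obtain ⟨y, hy, rfl⟩ := hx₀
  obtain ⟨r, hr, hball⟩ := Metric.mem_nhds_iff.1 (mem_interior_iff_mem_nhds.1 hy)
  have hfx₀ := (hspan _).1 hx₀G.2
  obtain ⟨K, hK, hKΩ, hqh⟩ := h2.exists_compact
  have hΦ := AffineQuasiHomogeneous.eq_zero_of_cone h1.1.2.2 h1.1.2.1 h1.1.1 h1.2 hK hKΩ
    (fun x hx => by
      obtain ⟨y, hy, -, -, L, -, hL⟩ := hqh x hx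
      exact ⟨y, hy, L, hL⟩) hull (Φ := LinearMap.toContinuousLinearMap (LinearMap.pi f))
    (x₀ := y) hr (fun v hv hvr => by
      have hmem : (y : Fin n → ℝ) + v ∈ affineSpan ℝ F := (hspan _).2 fun i => by
        have : f i v = 0 := congrFun hv i
        rw [map_add, hfx₀, this, add_zero]
      have : (⟨y + v, affineSpan_mono ℝ hFG hmem⟩ : affineSpan ℝ G) ∈ Metric.ball y r := by
        rw [Metric.mem_ball, Subtype.dist_eq]
        simpa using hvr
      exact (hball this).1)
    (fun v hv i => by
      have := hfle i _ hv
      rw [map_add, hfx₀] at this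
      simpa using this)
  have hempty : ∀ i, False := fun i => hf0 i
    (LinearMap.ext fun v => congrFun (DFunLike.congr_fun hΦ v) i)
  exact hF.affineSpan_ne_univ h1.1 hfr (eq_univ_of_forall fun y =>
    (hspan y).2 fun i => (hempty i).elim)

theorem isIrreducibleAut {n : ℕ} {Ω : Set (Fin n → ℝ)} (h1 : IsProperlyConvexDomain n Ω)
    (h2 : IsQuasiHomogeneous n Ω)
    (hull : closure Ω ⊆ closure (convexHull ℝ (extremePoints ℝ (closure Ω)))) :
    IsIrreducibleAut n Ω := by
  rintro ⟨S, hSne, hSuniv, hS⟩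
  obtain ⟨K, hK, hKΩ, hqh⟩ := h2.exists_compact
  have hSc : IsClosed (S : Set (Fin n → ℝ)) := S.closed_of_finiteDimensional
  have hsub : Ω ⊆ S := subset_of_extremePoints_subset hull S.convex hSc fun p hp =>
    extremePoint_mem_of_quasiHomogeneous h1.1.2.2 h1.1.2.1 h1.1.1 h1.2 hK hKΩ hSc hSne
      (fun x hx => by
        obtain ⟨y, hy, g, hg, L, hgL, hL⟩ := hqh x hx
        refine ⟨y, hy, L, hL, fun z hz => ?_⟩
        rw [← hgL, ← hS g hg]
        exact mem_image_of_mem _ hz) hp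
  have htop := h1.1.2.1.affineSpan_eq_top h1.1.1
  have : S = ⊤ := top_le_iff.1 (htop ▸ affineSpan_le.2 hsub)
  exact hSuniv (by rw [this, AffineSubspace.top_coe])

/-- if the closure of Ω is the closed convex hull of its extreme points,
then no face of Ω contained in ∂Ω is conic and Aut(Ω) is irreducible. -/
theorem no_conicFace_and_irreducible (n : ℕ) (Ω : Set (Fin n → ℝ))
    (h1 : IsProperlyConvexDomain n Ω) (h2 : IsQuasiHomogeneous n Ω)
    (hhull : closure Ω
        = closure (convexHull ℝ (Set.extremePoints ℝ (closure Ω)))) :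
    (∀ F : Set (Fin n → ℝ), IsFace n Ω F → F ⊆ frontier Ω → ¬ IsConicFace n Ω F) ∧
      IsIrreducibleAut n Ω := by
  exact ⟨fun _ hF hfr => not_isConicFace h1 h2 hhull.subset hF hfr,
    isIrreducibleAut h1 h2 hhull.subset⟩
end
end
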